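/- arXiv:1308.6596 — 3 statements merged into one kernel-verified Lean document; each statement's English description precedes it below -/
import Mathlib

section
/- Let d = 2 and let δ be the Weitzenböck derivation of F_2 with δ(x_1) = 0 and δ(x_2) = x_1, extended to K[U_2,V_2] by δ(u_1) = δ(v_1) = 0, δ(u_2) = u_1, δ(v_2) = v_1. Then (F_2')^δ is a free cyclic K[U_2,V_2]^δ-module generated by [x_2,x_1]: every element of (F_2')^δ is uniquely of the form [x_2,x_1]·h with h ∈ K[U_2,V_2]^δ. -/
noncomputable section

/-- The metabelian relation on the free associative algebra:
products of two commutators are identified with zero. -/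
def MetabRel (K : Type*) [CommRing K] (d : ℕ) (p q : FreeAlgebra K (Fin d)) : Prop :=
  q = 0 ∧ ∃ a b c e : FreeAlgebra K (Fin d), p = (a * b - b * a) * (c * e - e * c)

/-- The free metabelian associative algebra `F_d = A_d/(A_d')²`. -/
abbrev FreeMetab (K : Type*) [CommRing K] (d : ℕ) := RingQuot (MetabRel K d)

/-- The free generators `x_i` of `F_d`. -/
def xg (K : Type*) [CommRing K] (d : ℕ) (i : Fin d) : FreeMetab K d :=
  RingQuot.mkAlgHom K (MetabRel K d) (FreeAlgebra.ι K i)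

/-- The commutator ideal `F_d'`: the two-sided ideal generated by all commutators. -/
def commIdeal (K : Type*) [CommRing K] (d : ℕ) : Ideal (FreeMetab K d) :=
  Ideal.span {z | ∃ a f g b : FreeMetab K d, z = a * (f * g - g * f) * b}

/-- `K[U_d,V_d]`. -/
abbrev PolyUV (K : Type*) [CommRing K] (d : ℕ) := MvPolynomial (Fin d ⊕ Fin d) K

def uP (K : Type*) [CommRing K] (d : ℕ) (i : Fin d) : PolyUV K d := MvPolynomial.X (Sum.inl i)
def vP (K : Type*) [CommRing K] (d : ℕ) (i : Fin d) : PolyUV K d := MvPolynomial.X (Sum.inr i)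

/-- Action of a monomial of `K[U_d,V_d]` on `F_d`, implementing
`f·u_i = x_i f` and `f·v_i = [f,x_i]` (on the commutator ideal all the
individual operators commute, so the fixed order of composition is immaterial). -/
def monAct (K : Type*) [CommRing K] (d : ℕ) (m : (Fin d ⊕ Fin d) →₀ ℕ) :
    Module.End K (FreeMetab K d) :=
  (List.ofFn fun i : Fin d =>
      (LinearMap.mulLeft K (xg K d i) : Module.End K (FreeMetab K d)) ^ m (Sum.inl i)).prod *
  (List.ofFn fun i : Fin d =>
      (LinearMap.mulRight K (xg K d i) - LinearMap.mulLeft K (xg K d i) :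
        Module.End K (FreeMetab K d)) ^ m (Sum.inr i)).prod

/-- The action of `K[U_d,V_d]` on the commutator ideal of `F_d`. -/
def act (K : Type*) [CommRing K] (d : ℕ) (p : PolyUV K d) (w : FreeMetab K d) : FreeMetab K d :=
  ∑ m ∈ p.support, p.coeff m • (monAct K d m w)

namespace FM

variable {K : Type*} [Field K]

theorem ind {C : FreeMetab K 2 → Prop} (hr : ∀ r : K, C (algebraMap K _ r))
    (h0 : C (xg K 2 0)) (h1 : C (xg K 2 1)) (hm : ∀ a b, C a → C b → C (a * b))
    (ha : ∀ a b, C a → C b → C (a + b)) (z : FreeMetab K 2) : C z := by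
  obtain ⟨y, rfl⟩ := RingQuot.mkAlgHom_surjective K (MetabRel K 2) z
  induction y using FreeAlgebra.induction with
  | grade0 r => rw [AlgHom.commutes]; exact hr r
  | grade1 i =>
    fin_cases i
    · exact h0
    · exact h1
  | mul a b h h' => rw [map_mul]; exact hm _ _ h h'
  | add a b h h' => rw [map_add]; exact ha _ _ h h'

theorem metab (a b c e : FreeMetab K 2) : (a * b - b * a) * (c * e - e * c) = 0 := by
  obtain ⟨a, rfl⟩ := RingQuot.mkAlgHom_surjective K (MetabRel K 2) a
  obtain ⟨b, rfl⟩ := RingQuot.mkAlgHom_surjective K (MetabRel K 2) b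
  obtain ⟨c, rfl⟩ := RingQuot.mkAlgHom_surjective K (MetabRel K 2) c
  obtain ⟨e, rfl⟩ := RingQuot.mkAlgHom_surjective K (MetabRel K 2) e
  have h := RingQuot.mkAlgHom_rel K (s := MetabRel K 2)
    (x := (a * b - b * a) * (c * e - e * c)) (y := 0) ⟨rfl, a, b, c, e, rfl⟩
  simpa using h

theorem metab' (a b r c e : FreeMetab K 2) : (a * b - b * a) * r * (c * e - e * c) = 0 := by
  have h1 := metab a (b * r) c e
  have h2 := metab a r c e
  have : (a * b - b * a) * r * (c * e - e * c) =
    (a * (b * r) - b * r * a) * (c * e - e * c) - b * ((a * r - r * a) * (c * e - e * c)) := by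
    (simp only [mul_add, add_mul, mul_sub, sub_mul, mul_assoc]; abel)
  rw [this, h1, h2]; simp

theorem mul_right_mem {w : FreeMetab K 2} (hw : w ∈ commIdeal K 2) (x : FreeMetab K 2) :
    w * x ∈ commIdeal K 2 := by
  unfold commIdeal at hw
  induction hw using Submodule.span_induction with
  | mem z hz =>
    obtain ⟨a, f, g, b, rfl⟩ := hz
    exact Ideal.subset_span ⟨a, f, g, b * x, by rw [mul_assoc]⟩
  | zero => simp
  | add y z _ _ h h' => rw [add_mul]; exact add_mem h h'
  | smul a y _ h => rw [smul_eq_mul, mul_assoc]; exact Ideal.mul_mem_left _ _ h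

theorem comm_mul {w : FreeMetab K 2} (hw : w ∈ commIdeal K 2) :
    ∀ a b : FreeMetab K 2, (a * b - b * a) * w = 0 := by
  unfold commIdeal at hw
  induction hw using Submodule.span_induction with
  | mem z hz =>
    obtain ⟨r, f, g, s, rfl⟩ := hz
    intro a b
    rw [← mul_assoc, ← mul_assoc, metab', zero_mul]
  | zero => simp
  | add y z _ _ h h' => intro a b; rw [mul_add, h, h', add_zero]
  | smul r y _ h =>
    intro a b
    have : (a * b - b * a) * (r * y) =
      (a * (b * r) - b * r * a) * y - b * ((a * r - r * a) * y) := by (simp only [mul_add, add_mul, mul_sub, sub_mul, mul_assoc]; abel)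
    rw [smul_eq_mul, this, h, h]; simp

theorem mul_comm' {w : FreeMetab K 2} (hw : w ∈ commIdeal K 2) :
    ∀ a b : FreeMetab K 2, w * (a * b - b * a) = 0 := by
  unfold commIdeal at hw
  induction hw using Submodule.span_induction with
  | mem z hz =>
    obtain ⟨r, f, g, s, rfl⟩ := hz
    intro a b
    rw [mul_assoc, mul_assoc, ← mul_assoc _ s, metab', mul_zero]
  | zero => simp
  | add y z _ _ h h' => intro a b; rw [add_mul, h, h', add_zero]
  | smul r y _ h =>
    intro a b
    rw [smul_eq_mul, mul_assoc, h, mul_zero]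

/-- Pushing an operator through a power of another one on an invariant ideal. -/
theorem pow_push (J : Ideal (FreeMetab K 2)) (S T : Module.End K (FreeMetab K 2))
    (hT : ∀ w ∈ J, T w ∈ J) (hc : ∀ w ∈ J, S (T w) = T (S w)) (n : ℕ) :
    ∀ w ∈ J, S ((T ^ n) w) = (T ^ n) (S w) ∧ (T ^ n) w ∈ J := by
  induction n with
  | zero => intro w hw; simpa using hw
  | succ n ih =>
    intro w hw
    rw [pow_succ', Module.End.mul_apply, Module.End.mul_apply]
    obtain ⟨h1, h2⟩ := ih w hw
    exact ⟨by rw [hc _ h2, h1], hT _ h2⟩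

abbrev L (K : Type*) [Field K] (i : Fin 2) : Module.End K (FreeMetab K 2) :=
  LinearMap.mulLeft K (xg K 2 i)

abbrev D (K : Type*) [Field K] (i : Fin 2) : Module.End K (FreeMetab K 2) :=
  LinearMap.mulRight K (xg K 2 i) - LinearMap.mulLeft K (xg K 2 i)

theorem L_mem (i : Fin 2) : ∀ w ∈ commIdeal K 2, L K i w ∈ commIdeal K 2 := by
  intro w hw
  exact Ideal.mul_mem_left _ _ hw

theorem D_mem (i : Fin 2) : ∀ w ∈ commIdeal K 2, D K i w ∈ commIdeal K 2 := by
  intro w hw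
  exact sub_mem (mul_right_mem hw _) (Ideal.mul_mem_left _ _ hw)

theorem LL (i j : Fin 2) : ∀ w ∈ commIdeal K 2, L K i (L K j w) = L K j (L K i w) := by
  intro w hw
  have := comm_mul hw (xg K 2 i) (xg K 2 j)
  simp only [LinearMap.mulLeft_apply]
  rw [← sub_eq_zero, ← this]; (simp only [mul_add, add_mul, mul_sub, sub_mul, mul_assoc])

theorem DL (i j : Fin 2) : ∀ w ∈ commIdeal K 2, D K i (L K j w) = L K j (D K i w) := by
  intro w hw
  have := comm_mul hw (xg K 2 j) (xg K 2 i)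
  simp only [LinearMap.mulLeft_apply, LinearMap.sub_apply, LinearMap.mulRight_apply]
  rw [← sub_eq_zero, ← this]; (simp only [mul_add, add_mul, mul_sub, sub_mul, mul_assoc]; abel)

theorem DD (i j : Fin 2) : ∀ w ∈ commIdeal K 2, D K i (D K j w) = D K j (D K i w) := by
  intro w hw
  have h1 := comm_mul hw (xg K 2 i) (xg K 2 j)
  have h2 := mul_comm' hw (xg K 2 i) (xg K 2 j)
  simp only [LinearMap.mulLeft_apply, LinearMap.sub_apply, LinearMap.mulRight_apply]
  have h3 : (xg K 2 i * xg K 2 j - xg K 2 j * xg K 2 i) * w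
    - w * (xg K 2 i * xg K 2 j - xg K 2 j * xg K 2 i) = 0 := by rw [h1, h2, sub_zero]
  rw [← sub_eq_zero, ← h3]; (simp only [mul_add, add_mul, mul_sub, sub_mul, mul_assoc]; abel)

theorem monAct_eq (m : (Fin 2 ⊕ Fin 2) →₀ ℕ) (w : FreeMetab K 2) :
    monAct K 2 m w = (L K 0 ^ m (Sum.inl 0)) ((L K 1 ^ m (Sum.inl 1))
      ((D K 0 ^ m (Sum.inr 0)) ((D K 1 ^ m (Sum.inr 1)) w))) := by
  simp [monAct, List.ofFn_succ, Module.End.mul_apply]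

theorem Lpow_mem (i : Fin 2) (n : ℕ) : ∀ w ∈ commIdeal K 2, (L K i ^ n) w ∈ commIdeal K 2 :=
  fun w hw => (pow_push _ _ _ (L_mem i) (LL i i) n w hw).2

theorem Dpow_mem (i : Fin 2) (n : ℕ) : ∀ w ∈ commIdeal K 2, (D K i ^ n) w ∈ commIdeal K 2 :=
  fun w hw => (pow_push _ _ _ (D_mem i) (DD i i) n w hw).2

theorem monAct_u (i : Fin 2) (m : (Fin 2 ⊕ Fin 2) →₀ ℕ) {w : FreeMetab K 2}
    (hw : w ∈ commIdeal K 2) :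
    monAct K 2 (m + Finsupp.single (Sum.inl i) 1) w = L K i (monAct K 2 m w) := by
  have hD := Dpow_mem 0 (m (Sum.inr 0)) _ (Dpow_mem 1 (m (Sum.inr 1)) _ hw)
  have hL := Lpow_mem 1 (m (Sum.inl 1)) _ hD
  fin_cases i
  · simp [monAct_eq, pow_succ', Module.End.mul_apply, -LinearMap.pow_mulLeft]
  · have := (pow_push _ _ _ (L_mem 0) (LL 1 0) (m (Sum.inl 0)) _ hL).1
    simp only [monAct_eq]
    simp only [Fin.mk_one, this]
    simp [pow_succ', Module.End.mul_apply, -LinearMap.pow_mulLeft]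

theorem monAct_v (i : Fin 2) (m : (Fin 2 ⊕ Fin 2) →₀ ℕ) {w : FreeMetab K 2}
    (hw : w ∈ commIdeal K 2) :
    monAct K 2 (m + Finsupp.single (Sum.inr i) 1) w = D K i (monAct K 2 m w) := by
  have hD1 := Dpow_mem 1 (m (Sum.inr 1)) _ hw
  have hD := Dpow_mem 0 (m (Sum.inr 0)) _ hD1
  have hL := Lpow_mem 1 (m (Sum.inl 1)) _ hD
  have e1 := (pow_push _ _ _ (L_mem 0) (DL i 0) (m (Sum.inl 0)) _ hL).1
  have e2 := (pow_push _ _ _ (L_mem 1) (DL i 1) (m (Sum.inl 1)) _ hD).1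
  simp only [monAct_eq]
  rw [e1, e2]
  fin_cases i
  · simp [pow_succ', Module.End.mul_apply, -LinearMap.pow_mulLeft]
  · have := (pow_push _ _ _ (D_mem 0) (DD 1 0) (m (Sum.inr 0)) _ hD1).1
    simp only [Fin.mk_one, this]
    simp [pow_succ', Module.End.mul_apply, -LinearMap.pow_mulLeft]

/-- The action on a fixed element as a linear map. -/
def actL (w : FreeMetab K 2) : PolyUV K 2 →ₗ[K] FreeMetab K 2 :=
  (MvPolynomial.basisMonomials (Fin 2 ⊕ Fin 2) K).constr K (fun m => monAct K 2 m w)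

theorem actL_monomial (w : FreeMetab K 2) (m) (a : K) :
    actL w (MvPolynomial.monomial m a) = a • monAct K 2 m w := by
  have : (MvPolynomial.monomial m a : PolyUV K 2)
      = a • MvPolynomial.basisMonomials (Fin 2 ⊕ Fin 2) K m := by
    rw [MvPolynomial.coe_basisMonomials, MvPolynomial.smul_monomial, smul_eq_mul, mul_one]
  rw [this, map_smul, actL, Module.Basis.constr_basis]

theorem act_eq (p : PolyUV K 2) (w : FreeMetab K 2) : act K 2 p w = actL w p := by
  conv_rhs => rw [MvPolynomial.as_sum p, map_sum]
  simp only [actL_monomial]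
  rfl

theorem actL_u (i : Fin 2) (p : PolyUV K 2) {w : FreeMetab K 2} (hw : w ∈ commIdeal K 2) :
    actL w (p * MvPolynomial.X (Sum.inl i)) = xg K 2 i * actL w p := by
  induction p using MvPolynomial.induction_on' with
  | monomial m a =>
    rw [MvPolynomial.X, MvPolynomial.monomial_mul, actL_monomial, actL_monomial, monAct_u i m hw]
    simp
  | add p q h h' => rw [add_mul, map_add, map_add, h, h', mul_add]

theorem actL_v (i : Fin 2) (p : PolyUV K 2) {w : FreeMetab K 2} (hw : w ∈ commIdeal K 2) :
    actL w (p * MvPolynomial.X (Sum.inr i)) = actL w p * xg K 2 i - xg K 2 i * actL w p := by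
  induction p using MvPolynomial.induction_on' with
  | monomial m a =>
    rw [MvPolynomial.X, MvPolynomial.monomial_mul, actL_monomial, actL_monomial, monAct_v i m hw]
    simp [smul_sub]
  | add p q h h' => rw [add_mul, map_add, map_add, h, h']; (simp only [mul_add, add_mul, mul_sub, sub_mul, mul_assoc]; abel)

theorem actL_C (a : K) (w : FreeMetab K 2) : actL w (MvPolynomial.C a) = a • w := by
  rw [MvPolynomial.C_apply, actL_monomial, monAct_eq]; simp

/-- The commutator `[x₂,x₁]`. -/
abbrev c (K : Type*) [Field K] : FreeMetab K 2 := xg K 2 1 * xg K 2 0 - xg K 2 0 * xg K 2 1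

theorem c_mem : c K ∈ commIdeal K 2 :=
  Ideal.subset_span ⟨1, xg K 2 1, xg K 2 0, 1, by simp⟩

theorem range_left (r : FreeMetab K 2) :
    ∀ w ∈ LinearMap.range (actL (c K)), r * w ∈ LinearMap.range (actL (c K)) := by
  induction r using ind with
  | hr a =>
    intro w hw
    rw [← Algebra.smul_def]; exact Submodule.smul_mem _ _ hw
  | h0 => rintro _ ⟨p, rfl⟩; exact ⟨_, actL_u 0 p c_mem⟩
  | h1 => rintro _ ⟨p, rfl⟩; exact ⟨_, actL_u 1 p c_mem⟩
  | hm a b h h' => intro w hw; rw [mul_assoc]; exact h _ (h' _ hw)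
  | ha a b h h' => intro w hw; rw [add_mul]; exact add_mem (h _ hw) (h' _ hw)

theorem range_right_x (i : Fin 2) : ∀ w ∈ LinearMap.range (actL (c K)),
    w * xg K 2 i ∈ LinearMap.range (actL (c K)) := by
  rintro _ ⟨p, rfl⟩
  refine ⟨p * MvPolynomial.X (Sum.inr i) + p * MvPolynomial.X (Sum.inl i), ?_⟩
  rw [map_add, actL_u i p c_mem, actL_v i p c_mem, sub_add_cancel]

theorem range_right (r : FreeMetab K 2) :
    ∀ w ∈ LinearMap.range (actL (c K)), w * r ∈ LinearMap.range (actL (c K)) := by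
  induction r using ind with
  | hr a =>
    intro w hw
    rw [← Algebra.commutes, ← Algebra.smul_def]; exact Submodule.smul_mem _ _ hw
  | h0 => exact range_right_x 0
  | h1 => exact range_right_x 1
  | hm a b h h' => intro w hw; rw [← mul_assoc]; exact h' _ (h _ hw)
  | ha a b h h' => intro w hw; rw [mul_add]; exact add_mem (h _ hw) (h' _ hw)

theorem c_range : c K ∈ LinearMap.range (actL (c K)) :=
  ⟨MvPolynomial.C 1, by rw [actL_C, one_smul]⟩

theorem comm_range_aux (f : FreeMetab K 2)
    (h0 : f * xg K 2 0 - xg K 2 0 * f ∈ LinearMap.range (actL (c K)))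
    (h1 : f * xg K 2 1 - xg K 2 1 * f ∈ LinearMap.range (actL (c K))) (g : FreeMetab K 2) :
    f * g - g * f ∈ LinearMap.range (actL (c K)) := by
  induction g using ind with
  | hr a => rw [Algebra.commutes, sub_self]; exact zero_mem _
  | h0 => exact h0
  | h1 => exact h1
  | hm a b h h' =>
    have : f * (a * b) - a * b * f = (f * a - a * f) * b + a * (f * b - b * f) := by (simp only [mul_add, add_mul, mul_sub, sub_mul, mul_assoc]; abel)
    rw [this]
    exact add_mem (range_right _ _ h) (range_left _ _ h')
  | ha a b h h' =>
    have : f * (a + b) - (a + b) * f = (f * a - a * f) + (f * b - b * f) := by (simp only [mul_add, add_mul, mul_sub, sub_mul, mul_assoc]; abel)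
    rw [this]
    exact add_mem h h'

theorem comm_range (f g : FreeMetab K 2) :
    f * g - g * f ∈ LinearMap.range (actL (c K)) := by
  have hneg : ∀ f g : FreeMetab K 2, f * g - g * f ∈ LinearMap.range (actL (c K)) →
      g * f - f * g ∈ LinearMap.range (actL (c K)) := by
    intro f g h
    rw [← neg_sub]; exact neg_mem h
  refine comm_range_aux f ?_ ?_ g
  · refine hneg _ _ (comm_range_aux _ ?_ ?_ _)
    · rw [sub_self]; exact zero_mem _
    · exact hneg _ _ c_range
  · refine hneg _ _ (comm_range_aux _ ?_ ?_ _)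
    · exact c_range
    · rw [sub_self]; exact zero_mem _

theorem surj {w : FreeMetab K 2} (hw : w ∈ commIdeal K 2) :
    w ∈ LinearMap.range (actL (c K)) := by
  unfold commIdeal at hw
  induction hw using Submodule.span_induction with
  | mem z hz =>
    obtain ⟨r, f, g, s, rfl⟩ := hz
    exact range_right _ _ (range_left _ _ (comm_range f g))
  | zero => exact zero_mem _
  | add y z _ _ h h' => exact add_mem h h'
  | smul r y _ h => exact range_left _ _ h

/-- The triangular matrix model on the free algebra. -/
def psi0 (K : Type*) [Field K] :
    FreeAlgebra K (Fin 2) →ₐ[K] Matrix (Fin 2) (Fin 2) (PolyUV K 2) :=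
  FreeAlgebra.lift K (fun i : Fin 2 =>
    !![MvPolynomial.X (Sum.inl i), if i = 0 then 1 else 0;
       0, MvPolynomial.X (Sum.inl i) + MvPolynomial.X (Sum.inr i)])

theorem psi0_tri (a : FreeAlgebra K (Fin 2)) : psi0 K a 1 0 = 0 := by
  induction a using FreeAlgebra.induction with
  | grade0 r => rw [AlgHom.commutes]; simp [Matrix.algebraMap_matrix_apply]
  | grade1 i => simp [psi0]
  | mul a b h h' => rw [map_mul, Matrix.mul_apply, Fin.sum_univ_two, h, h']; simp
  | add a b h h' => rw [map_add, Matrix.add_apply, h, h', add_zero]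

theorem psi0_comm (a b : FreeAlgebra K (Fin 2)) :
    ∃ t, psi0 K (a * b - b * a) = !![0, t; 0, 0] := by
  refine ⟨psi0 K (a * b - b * a) 0 1, ?_⟩
  ext1 i j
  have ha := psi0_tri a
  have hb := psi0_tri b
  fin_cases i <;> fin_cases j <;>
    simp [map_sub, map_mul, Matrix.sub_apply, Matrix.mul_apply, Fin.sum_univ_two, ha, hb] <;> ring

/-- The triangular matrix model of the free metabelian algebra. -/
def psi (K : Type*) [Field K] :
    FreeMetab K 2 →ₐ[K] Matrix (Fin 2) (Fin 2) (PolyUV K 2) :=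
  RingQuot.liftAlgHom K ⟨psi0 K, by
    rintro x y ⟨rfl, a, b, p, q, rfl⟩
    obtain ⟨s, hs⟩ := psi0_comm a b
    obtain ⟨t, ht⟩ := psi0_comm p q
    rw [map_mul, hs, ht, map_zero]
    ext1 i j
    fin_cases i <;> fin_cases j <;> simp⟩

theorem psi_x (i : Fin 2) : psi K (xg K 2 i) =
    !![MvPolynomial.X (Sum.inl i), if i = 0 then 1 else 0;
       0, MvPolynomial.X (Sum.inl i) + MvPolynomial.X (Sum.inr i)] := by
  simp [psi, xg, psi0]

theorem psi_act (p : PolyUV K 2) :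
    psi K (actL (c K) p) = !![0, -(MvPolynomial.X (Sum.inr 1)) * p; 0, 0] := by
  induction p using MvPolynomial.induction_on with
  | C a =>
    rw [actL_C, map_smul, map_sub, map_mul, map_mul, psi_x, psi_x]
    ext1 i j
    fin_cases i <;> fin_cases j <;> simp [MvPolynomial.smul_eq_C_mul, mul_comm]
  | add p q h h' =>
    rw [map_add, map_add, h, h']
    ext1 i j
    fin_cases i <;> fin_cases j <;> simp <;> ring
  | mul_X p i h =>
    rcases i with i | i
    · rw [actL_u i p c_mem, map_mul, h, psi_x]
      ext1 k j
      fin_cases k <;> fin_cases j <;> fin_cases i <;> simp <;> ring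
    · rw [actL_v i p c_mem, map_sub, map_mul, map_mul, h, psi_x]
      ext1 k j
      fin_cases k <;> fin_cases j <;> fin_cases i <;> simp <;> ring

theorem inj : Function.Injective (actL (c K)) := by
  rw [← LinearMap.ker_eq_bot, LinearMap.ker_eq_bot']
  intro p hp
  have h := psi_act p
  rw [hp, map_zero] at h
  have h01 := congrFun (congrFun h 0) 1
  simp at h01
  exact h01

end FM

/-- For `d = 2` and the Weitzenböck derivation with `δ(x₁) = 0`,
`δ(x₂) = x₁`, the space of constants `(F₂')^δ` is a free cyclic `K[U₂,V₂]^δ`-module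
generated by `[x₂,x₁]`: every element is uniquely of the form `[x₂,x₁]·h`
with `h ∈ K[U₂,V₂]^δ`. -/
theorem free_cyclic_module_d2
    (K : Type*) [Field K] [CharZero K]
    (δ : FreeMetab K 2 →ₗ[K] FreeMetab K 2)
    (hleib : ∀ a b : FreeMetab K 2, δ (a * b) = δ a * b + a * δ b)
    (h1 : δ (xg K 2 0) = 0) (h2 : δ (xg K 2 1) = xg K 2 0)
    (δ' : Derivation K (PolyUV K 2) (PolyUV K 2))
    (hu1 : δ' (uP K 2 0) = 0) (hu2 : δ' (uP K 2 1) = uP K 2 0)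
    (hv1 : δ' (vP K 2 0) = 0) (hv2 : δ' (vP K 2 1) = vP K 2 0) :
    ∀ w ∈ commIdeal K 2, δ w = 0 →
      ∃ h : PolyUV K 2, δ' h = 0 ∧
        w = act K 2 h (xg K 2 1 * xg K 2 0 - xg K 2 0 * xg K 2 1) ∧
        ∀ h' : PolyUV K 2, δ' h' = 0 →
          w = act K 2 h' (xg K 2 1 * xg K 2 0 - xg K 2 0 * xg K 2 1) → h' = h := by
  have hc : δ (FM.c K) = 0 := by
    rw [map_sub, hleib, hleib, h1, h2]; simp
  have key : ∀ p : PolyUV K 2, δ (FM.actL (FM.c K) p) = FM.actL (FM.c K) (δ' p) := by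
    have hx : ∀ i : Fin 2, ∃ a : K, δ (xg K 2 i) = a • xg K 2 0 ∧
        δ' (MvPolynomial.X (Sum.inl i)) = a • MvPolynomial.X (Sum.inl 0) ∧
        δ' (MvPolynomial.X (Sum.inr i)) = a • MvPolynomial.X (Sum.inr 0) := by
      intro i
      fin_cases i
      · exact ⟨0, by simpa using h1, by simpa [uP] using hu1, by simpa [vP] using hv1⟩
      · exact ⟨1, by simpa using h2, by simpa [uP] using hu2, by simpa [vP] using hv2⟩
    intro p
    induction p using MvPolynomial.induction_on with
    | C a =>
      rw [FM.actL_C, map_smul, hc, smul_zero]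
      have : δ' (MvPolynomial.C a) = 0 := δ'.map_algebraMap a
      rw [this, map_zero]
    | add p q h h' => simp only [map_add, h, h']
    | mul_X p i h =>
      rcases i with i | i
      · obtain ⟨a, e1, e2, e3⟩ := hx i
        rw [FM.actL_u i p FM.c_mem, hleib, e1, h, Derivation.leibniz, e2, smul_eq_mul,
          smul_eq_mul, mul_smul_comm, mul_comm _ (δ' p), map_add, map_smul,
          FM.actL_u _ _ FM.c_mem, FM.actL_u _ _ FM.c_mem, smul_mul_assoc]
      · obtain ⟨a, e1, e2, e3⟩ := hx i
        rw [FM.actL_v i p FM.c_mem, map_sub, hleib, hleib, e1, h, Derivation.leibniz, e3,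
          smul_eq_mul, smul_eq_mul, mul_smul_comm a p, mul_comm _ (δ' p), map_add, map_smul,
          FM.actL_v _ _ FM.c_mem, FM.actL_v _ _ FM.c_mem, smul_mul_assoc, mul_smul_comm, smul_sub]
        abel
  intro w hw hδ
  obtain ⟨p, rfl⟩ := FM.surj hw
  refine ⟨p, ?_, (FM.act_eq _ _).symm, ?_⟩
  · apply FM.inj
    rw [← key, hδ, map_zero]
  · intro h' _ e
    rw [FM.act_eq] at e
    exact FM.inj e.symm
end
end

section
/- Let d = 2 and let δ be the Weitzenböck derivation of F_2 with δ(x_1) = 0 and δ(x_2) = x_1. Then the Hilbert series of the algebra of constants F_2^δ satisfies H(F_2^δ, z) = 1/(1−z) + z²/((1−z)²(1−z²)) in ℤ[[z]]; equivalently, (1−z)²(1−z²)·H(F_2^δ, z) = (1−z)(1−z²) + z². -/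
noncomputable section

/-- The homogeneous component of total degree `n` of `F_d`:
the image in `F_d` of the span of the words of length `n`. -/
def degComp (K : Type*) [CommRing K] (d n : ℕ) : Submodule K (FreeMetab K d) :=
  Submodule.map (RingQuot.mkAlgHom K (MetabRel K d)).toLinearMap
    (Submodule.span K {w : FreeAlgebra K (Fin d) | ∃ l : List (Fin d),
      l.length = n ∧ w = (l.map (FreeAlgebra.ι K)).prod})



/-- Closed form count. -/
theorem hs_card (n : ℕ) : ∑ k ∈ Finset.range (n/2), (n - 1 - 2*k) = n^2/4 := by
  induction n using Nat.strong_induction_on with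
  | _ n ih =>
    match n with
    | 0 => simp
    | 1 => simp
    | n+2 =>
      have h : (n+2)/2 = n/2+1 := by omega
      rw [h, Finset.sum_range_succ']
      have e : ∀ k, n + 2 - 1 - 2*(k+1) = n - 1 - 2*k := by intro k; omega
      simp only [e]
      rw [ih n (by omega)]
      have : (n+2)^2 = n^2 + 4*(n+1) := by ring
      rw [this]; omega

theorem hs_series (h : ℕ → ℕ) (hh : ∀ n, h n = 1 + n^2/4) :
    (1 - PowerSeries.X : PowerSeries ℤ) ^ 2 * (1 - PowerSeries.X ^ 2) *
        (PowerSeries.mk fun n => (h n : ℤ))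
      = (1 - PowerSeries.X) * (1 - PowerSeries.X ^ 2) + PowerSeries.X ^ 2 := by
  have e1 : (1 - PowerSeries.X : PowerSeries ℤ) ^ 2 * (1 - PowerSeries.X ^ 2) *
        (PowerSeries.mk fun n => (h n : ℤ)) = (PowerSeries.mk fun n => (h n : ℤ))
        - 2 * (PowerSeries.X ^ 1 * (PowerSeries.mk fun n => (h n : ℤ)))
        + 2 * (PowerSeries.X ^ 3 * (PowerSeries.mk fun n => (h n : ℤ)))
        - (PowerSeries.X ^ 4 * (PowerSeries.mk fun n => (h n : ℤ))) := by ring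
  have e2 : (1 - PowerSeries.X : PowerSeries ℤ) * (1 - PowerSeries.X ^ 2) + PowerSeries.X ^ 2
     = 1 - PowerSeries.X ^ 1 + PowerSeries.X ^ 3 := by ring
  rw [e1, e2]
  ext n
  have two : ∀ p : PowerSeries ℤ, PowerSeries.coeff n (2 * p) = 2 * PowerSeries.coeff n p := by
    intro p; rw [two_mul, two_mul, map_add]
  simp only [map_add, map_sub, two, PowerSeries.coeff_X_pow_mul', PowerSeries.coeff_mk,
    PowerSeries.coeff_X_pow, PowerSeries.coeff_one, hh]
  match n with
  | 0 => simp
  | 1 => simp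
  | 2 => simp
  | 3 => simp
  | n+4 =>
    have a1 : n + 4 - 1 = n+3 := by omega
    have a2 : n + 4 - 3 = n+1 := by omega
    have a3 : n + 4 - 4 = n := by omega
    have b1 : (n+1)^2 = n^2+2*n+1 := by ring
    have b3 : (n+3)^2 = n^2+6*n+9 := by ring
    have b4 : (n+4)^2 = n^2+8*n+16 := by ring
    rw [a1, a2, a3, b1, b3, b4]
    simp
    obtain ⟨t, rfl | rfl⟩ := n.even_or_odd'
    · have : ((2*t : ℕ):ℤ)^2 = 4 * (t*t:ℤ) := by push_cast; ring
      rw [this]; push_cast; generalize (t*t:ℤ) = z; omega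
    · have : ((2*t+1 : ℕ):ℤ)^2 = 4 * (t*t:ℤ) + 4*t+1 := by push_cast; ring
      rw [this]; push_cast; generalize (t*t:ℤ) = z; omega

/-- exponent vectors -/
def hsE (p i q j : ℕ) : Fin 4 →₀ ℕ := Finsupp.equivFunOnFinite.symm ![p, i, q, j]

theorem hsE_eta (m : Fin 4 →₀ ℕ) : m = hsE (m 0) (m 1) (m 2) (m 3) := by
  ext t; fin_cases t <;> simp [hsE]

theorem hsE_monomial (K : Type*) [Field K] (p i q j : ℕ) :
    (MvPolynomial.monomial (hsE p i q j) (1 : K)) =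
      MvPolynomial.X 0 ^ p * MvPolynomial.X 1 ^ i * MvPolynomial.X 2 ^ q * MvPolynomial.X 3 ^ j := by
  rw [MvPolynomial.monomial_eq, Finsupp.prod_fintype _ _ (by simp)]
  simp [Fin.prod_univ_four, hsE]

/-- The Weitzenböck derivation on the polynomial ring. -/
def hsD (K : Type*) [Field K] : MvPolynomial (Fin 4) K →ₗ[K] MvPolynomial (Fin 4) K :=
  (LinearMap.mulLeft K (MvPolynomial.X 0)) ∘ₗ (MvPolynomial.pderiv 1).toLinearMap +
  (LinearMap.mulLeft K (MvPolynomial.X 2)) ∘ₗ (MvPolynomial.pderiv 3).toLinearMap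

theorem hsD_apply (K : Type*) [Field K] (r : MvPolynomial (Fin 4) K) :
    hsD K r = MvPolynomial.X 0 * MvPolynomial.pderiv 1 r
      + MvPolynomial.X 2 * MvPolynomial.pderiv 3 r := rfl

theorem hsD_mul (K : Type*) [Field K] (r s : MvPolynomial (Fin 4) K) :
    hsD K (r * s) = hsD K r * s + r * hsD K s := by
  simp only [hsD_apply, MvPolynomial.pderiv_mul]; ring

/-- Polynomials all of whose monomials have degree `n - 2`. -/
def hsH (K : Type*) [Field K] (n : ℕ) : Submodule K (MvPolynomial (Fin 4) K) where
  carrier := {r | ∀ m, r.coeff m ≠ 0 → m 0 + m 1 + m 2 + m 3 + 2 = n}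
  zero_mem' := by intro m h; simp at h
  add_mem' := by
    intro a b ha hb m h
    by_cases h1 : a.coeff m = 0
    · refine hb m fun h2 => h ?_
      simp [h1, h2]
    · exact ha m h1
  smul_mem' := by
    intro c a ha m h
    refine ha m fun h2 => h ?_
    simp [h2]

theorem hsH_X_mul {K : Type*} [Field K] {n : ℕ} {r : MvPolynomial (Fin 4) K} (hr : r ∈ hsH K n)
    (t : Fin 4) : MvPolynomial.X t * r ∈ hsH K (n+1) := by
  intro m h
  rw [MvPolynomial.coeff_X_mul'] at h
  split_ifs at h with ht
  · have := hr _ h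
    simp only [Finsupp.mem_support_iff] at ht
    fin_cases t <;> simp at this ht <;> omega
  · simp at h

theorem hsH_one (K : Type*) [Field K] : (1 : MvPolynomial (Fin 4) K) ∈ hsH K 2 := by
  intro m h
  rw [MvPolynomial.coeff_one] at h
  split_ifs at h with hm
  · subst hm; simp
  · simp at h

theorem hsH_X_pow_mul {K : Type*} [Field K] {n : ℕ} {r : MvPolynomial (Fin 4) K}
    (hr : r ∈ hsH K n) (t : Fin 4) (k : ℕ) : MvPolynomial.X t ^ k * r ∈ hsH K (n+k) := by
  induction k with
  | zero => simpa using hr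
  | succ k ih =>
    have := hsH_X_mul ih t
    rwa [← mul_assoc, ← pow_succ'] at this

theorem hsH_w_pow_mul {K : Type*} [Field K] {n : ℕ} {r : MvPolynomial (Fin 4) K}
    (hr : r ∈ hsH K n) (k : ℕ) : (MvPolynomial.X 0 * MvPolynomial.X 3 -
      MvPolynomial.X 2 * MvPolynomial.X 1) ^ k * r ∈ hsH K (n+2*k) := by
  induction k with
  | zero => simpa using hr
  | succ k ih =>
    have h := Submodule.sub_mem _ (hsH_X_mul (hsH_X_mul ih 3) 0) (hsH_X_mul (hsH_X_mul ih 1) 2)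
    rw [show n + 2 * (k+1) = n + 2 * k + 1 + 1 by ring]
    convert h using 1
    ring

theorem hsD_coeff {K : Type*} [Field K] (r : MvPolynomial (Fin 4) K) (p i q j : ℕ) :
    (hsD K r).coeff (hsE p i q j) =
      (if p = 0 then 0 else r.coeff (hsE (p-1) (i+1) q j) * (i+1)) +
      (if q = 0 then 0 else r.coeff (hsE p i (q-1) (j+1)) * (j+1)) := by
  rw [hsD_apply, MvPolynomial.coeff_add, MvPolynomial.coeff_X_mul', MvPolynomial.coeff_X_mul']
  simp only [MvPolynomial.coeff_pderiv]
  have e1 : hsE p i q j - Finsupp.single 0 1 + Finsupp.single 1 1 = hsE (p-1) (i+1) q j := by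
    ext t; rw [Finsupp.add_apply, Finsupp.tsub_apply]; fin_cases t <;> simp [hsE]
  have e2 : hsE p i q j - Finsupp.single 2 1 + Finsupp.single 3 1 = hsE p i (q-1) (j+1) := by
    ext t; rw [Finsupp.add_apply, Finsupp.tsub_apply]; fin_cases t <;> simp [hsE]
  rw [e1, e2]
  simp [hsE]

theorem hsD_ker_A {K : Type*} [Field K] [CharZero K] {r : MvPolynomial (Fin 4) K}
    (hr : hsD K r = 0) (p i q j : ℕ) (h : p < j) : r.coeff (hsE p i q j) = 0 := by
  induction p generalizing i q j with
  | zero =>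
    obtain ⟨j, rfl⟩ : ∃ j', j = j' + 1 := ⟨j-1, by omega⟩
    have := hsD_coeff r 0 i (q+1) j
    rw [hr] at this
    have hj : (j:K) + 1 ≠ 0 := by exact_mod_cast Nat.succ_ne_zero j
    simpa [hj] using this
  | succ p ih =>
    obtain ⟨j, rfl⟩ : ∃ j', j = j' + 1 := ⟨j-1, by omega⟩
    have := hsD_coeff r (p+1) i (q+1) j
    have h0 := ih (i+1) (q+1) j (by omega)
    rw [hr] at this
    have hj : (j:K) + 1 ≠ 0 := by exact_mod_cast Nat.succ_ne_zero j
    simpa [hj, h0] using this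

theorem hsD_ker_B {K : Type*} [Field K] [CharZero K] {r : MvPolynomial (Fin 4) K}
    (hr : hsD K r = 0) (h0 : ∀ p q j, r.coeff (hsE p 0 q j) = 0) : r = 0 := by
  have key : ∀ i p q j, r.coeff (hsE p i q j) = 0 := by
    intro i
    induction i with
    | zero => exact h0
    | succ i ih =>
      intro p q j
      have := hsD_coeff r (p+1) i q j
      have hj : (i:K) + 1 ≠ 0 := by exact_mod_cast Nat.succ_ne_zero i
      rw [hr] at this
      simpa [hj, ih] using this
  ext m
  rw [hsE_eta m, key]; simp

/-- index set for the basis of constants: pairs `(k, q)` -/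
def hsS (n : ℕ) : Finset (Σ _ : ℕ, ℕ) := (Finset.range (n/2)).sigma fun k => Finset.range (n-1-2*k)

theorem hsS_card (n : ℕ) : (hsS n).card = n^2/4 := by
  rw [hsS, Finset.card_sigma]; simp [hs_card]

theorem hsS_mem (n k q : ℕ) : (⟨k, q⟩ : Σ _ : ℕ, ℕ) ∈ hsS n ↔ q + 2*k + 2 ≤ n := by
  simp [hsS]; omega

/-- constants of degree `n-2` -/
def hsN (K : Type*) [Field K] (n : ℕ) : Submodule K (MvPolynomial (Fin 4) K) :=
  LinearMap.ker (hsD K) ⊓ hsH K n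

/-- coordinates of a constant -/
def hsC (K : Type*) [Field K] (n : ℕ) : hsN K n →ₗ[K] (hsS n → K) :=
  LinearMap.pi fun s =>
    (MvPolynomial.lcoeff K (hsE (n-2-s.1.1-s.1.2) 0 s.1.2 s.1.1)) ∘ₗ (hsN K n).subtype

theorem hsC_apply (K : Type*) [Field K] (n : ℕ) (r : hsN K n) (s) :
    hsC K n r s = r.1.coeff (hsE (n-2-s.1.1-s.1.2) 0 s.1.2 s.1.1) := rfl

theorem hsC_inj (K : Type*) [Field K] [CharZero K] (n : ℕ) : Function.Injective (hsC K n) := by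
  rw [injective_iff_map_eq_zero]
  intro r hr
  have hk : hsD K r.1 = 0 := r.2.1
  refine Subtype.ext (hsD_ker_B hk ?_)
  intro p q j
  by_cases h : p < j
  · exact hsD_ker_A hk _ _ _ _ h
  · by_contra hc
    have hd := r.2.2 _ hc
    simp [hsE] at hd
    have := congrFun hr ⟨⟨j, q⟩, (hsS_mem n j q).2 (by omega)⟩
    rw [hsC_apply] at this
    apply hc
    have e : n-2-j-q = p := by omega
    simpa [e] using this

/-- basic constants -/
def hsV (K : Type*) [Field K] (p q k : ℕ) : MvPolynomial (Fin 4) K :=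
  (MvPolynomial.X 0 * MvPolynomial.X 3 - MvPolynomial.X 2 * MvPolynomial.X 1) ^ k *
    (MvPolynomial.X 0 ^ p * (MvPolynomial.X 2 ^ q * 1))

theorem hsD_pow (K : Type*) [Field K] {r : MvPolynomial (Fin 4) K} (hr : hsD K r = 0) (k : ℕ) :
    hsD K (r^k) = 0 := by
  induction k with
  | zero => rw [pow_zero]; simp [hsD_apply]
  | succ k ih => rw [pow_succ, hsD_mul, ih, hr]; simp

theorem hsV_mem (K : Type*) [Field K] (p q k n : ℕ) (h : p+q+2*k+2=n) : hsV K p q k ∈ hsN K n := by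
  constructor
  · show hsD K _ = 0
    have h1 : hsD K (MvPolynomial.X 0) = 0 := by
      simp [hsD_apply, MvPolynomial.pderiv_X]
    have h2 : hsD K (MvPolynomial.X 2) = 0 := by
      simp [hsD_apply, MvPolynomial.pderiv_X]
    have h3 : hsD K (MvPolynomial.X 0 * MvPolynomial.X 3 -
        MvPolynomial.X 2 * MvPolynomial.X 1) = 0 := by
      rw [map_sub, hsD_mul, hsD_mul, h1, h2]
      simp [hsD_apply, MvPolynomial.pderiv_X]
      ring
    rw [hsV, hsD_mul, hsD_mul, hsD_pow K h1, hsD_pow K h3, mul_one, hsD_pow K h2]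
    simp
  · have := hsH_w_pow_mul (hsH_X_pow_mul (hsH_X_pow_mul (hsH_one K) 2 q) 0 p) k
    rw [show n = 2 + q + p + 2 * k by omega]
    exact this

theorem hsV_coeff (K : Type*) [Field K] (p q k P Q L : ℕ) :
    (hsV K p q k).coeff (hsE P 0 Q L) = if (P = p + k ∧ Q = q ∧ L = k) then 1 else 0 := by
  have h1 : ∃ g, hsV K p q k = MvPolynomial.monomial (hsE (p+k) 0 q k) (1:K) +
      MvPolynomial.X 1 * g := by
    obtain ⟨c, hc⟩ := sub_dvd_pow_sub_pow (MvPolynomial.X 0 * MvPolynomial.X 3 -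
        MvPolynomial.X 2 * MvPolynomial.X 1 : MvPolynomial (Fin 4) K)
        (MvPolynomial.X 0 * MvPolynomial.X 3) k
    refine ⟨- MvPolynomial.X 2 * c * (MvPolynomial.X 0 ^ p * (MvPolynomial.X 2 ^ q * 1)), ?_⟩
    rw [hsE_monomial, hsV]
    rw [sub_eq_iff_eq_add] at hc
    rw [hc]; ring
  obtain ⟨g, hg⟩ := h1
  rw [hg, MvPolynomial.coeff_add, MvPolynomial.coeff_monomial, MvPolynomial.coeff_X_mul']
  rw [if_neg (show ¬ (1 : Fin 4) ∈ (hsE P 0 Q L).support by simp [hsE]), add_zero]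
  congr 1
  apply propext
  constructor
  · intro h
    have a0 := DFunLike.congr_fun h 0
    have a2 := DFunLike.congr_fun h 2
    have a3 := DFunLike.congr_fun h 3
    simp [hsE] at a0 a2 a3
    omega
  · rintro ⟨rfl, rfl, rfl⟩; rfl

theorem hsC_surj (K : Type*) [Field K] (n : ℕ) : Function.Surjective (hsC K n) := by
  intro g
  have hm : ∀ s : hsS n, (n-2-2*s.1.1-s.1.2) + s.1.2 + 2*s.1.1 + 2 = n := by
    rintro ⟨⟨k, q⟩, hs⟩
    rw [hsS_mem] at hs
    simp only
    omega
  refine ⟨∑ s, g s • ⟨hsV K (n-2-2*s.1.1-s.1.2) s.1.2 s.1.1, hsV_mem K _ _ _ n (hm s)⟩, ?_⟩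
  ext t
  rw [map_sum, Finset.sum_apply, Finset.sum_eq_single t]
  · rw [map_smul, Pi.smul_apply, hsC_apply, hsV_coeff, if_pos]
    · simp
    · have := hm t
      refine ⟨by omega, rfl, rfl⟩
  · intro s _ hst
    rw [map_smul, Pi.smul_apply, hsC_apply, hsV_coeff, if_neg]
    · simp
    · rintro ⟨-, h2, h3⟩
      apply hst
      obtain ⟨⟨k, q⟩, hs⟩ := s
      obtain ⟨⟨k', q'⟩, hs'⟩ := t
      simp only at h2 h3
      subst h2 h3
      rfl
  · simp

/-- coordinates as an equivalence -/
def hsCe (K : Type*) [Field K] [CharZero K] (n : ℕ) : hsN K n ≃ₗ[K] (hsS n → K) :=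
  LinearEquiv.ofBijective (hsC K n) ⟨hsC_inj K n, hsC_surj K n⟩

theorem hsN_finrank (K : Type*) [Field K] [CharZero K] (n : ℕ) :
    Module.finrank K (hsN K n) = n^2/4 := by
  rw [(hsCe K n).finrank_eq, Module.finrank_pi, Fintype.card_coe, hsS_card]

theorem hs_comm_zero (K : Type*) [Field K] (f g h k l : FreeMetab K 2) :
    (f * g - g * f) * h * (k * l - l * k) = 0 := by
  have base : ∀ f g k l : FreeMetab K 2, (f * g - g * f) * (k * l - l * k) = 0 := by
    intro f g k l
    obtain ⟨f, rfl⟩ := RingQuot.mkAlgHom_surjective K (MetabRel K 2) f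
    obtain ⟨g, rfl⟩ := RingQuot.mkAlgHom_surjective K (MetabRel K 2) g
    obtain ⟨k, rfl⟩ := RingQuot.mkAlgHom_surjective K (MetabRel K 2) k
    obtain ⟨l, rfl⟩ := RingQuot.mkAlgHom_surjective K (MetabRel K 2) l
    have := RingQuot.mkAlgHom_rel K (s := MetabRel K 2)
      (x := (f * g - g * f) * (k * l - l * k)) (y := 0) ⟨rfl, f, g, k, l, rfl⟩
    simpa only [map_mul, map_sub, map_zero] using this
  have e : (f * g - g * f) * h * (k * l - l * k) =
      (f * (g * h) - (g * h) * f) * (k * l - l * k)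
        - g * ((f * h - h * f) * (k * l - l * k)) := by
    generalize k * l - l * k = c
    simp only [sub_mul, mul_sub, mul_assoc]; abel
  rw [e, base, base]; simp

/-- The commutator of the generators. -/
def hsc (K : Type*) [Field K] : FreeMetab K 2 := xg K 2 0 * xg K 2 1 - xg K 2 1 * xg K 2 0

/-- The parametrization of the commutator ideal by polynomials. -/
def hsPsi (K : Type*) [Field K] : MvPolynomial (Fin 4) K →ₗ[K] FreeMetab K 2 :=
  (MvPolynomial.basisMonomials (Fin 4) K).constr K fun m =>
    (xg K 2 0 ^ m 0 * xg K 2 1 ^ m 1) * hsc K * (xg K 2 0 ^ m 2 * xg K 2 1 ^ m 3)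

theorem hsPsi_monomial (K : Type*) [Field K] (m : Fin 4 →₀ ℕ) :
    hsPsi K (MvPolynomial.monomial m 1) =
    (xg K 2 0 ^ m 0 * xg K 2 1 ^ m 1) * hsc K * (xg K 2 0 ^ m 2 * xg K 2 1 ^ m 3) := by
  have := (MvPolynomial.basisMonomials (Fin 4) K).constr_basis K (fun m =>
    (xg K 2 0 ^ m 0 * xg K 2 1 ^ m 1) * hsc K * (xg K 2 0 ^ m 2 * xg K 2 1 ^ m 3)) m
  rwa [MvPolynomial.coe_basisMonomials] at this

theorem hsPsi_one (K : Type*) [Field K] : hsPsi K 1 = hsc K := by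
  have := hsPsi_monomial K 0
  simpa using this

theorem hs_ext {K : Type*} [Field K] {M : Type*} [AddCommGroup M] [Module K M]
    {f g : MvPolynomial (Fin 4) K →ₗ[K] M}
    (h : ∀ m, f (MvPolynomial.monomial m 1) = g (MvPolynomial.monomial m 1)) : f = g := by
  apply (MvPolynomial.basisMonomials (Fin 4) K).ext
  intro m
  simpa using h m

theorem hsPsi_X0 (K : Type*) [Field K] (r : MvPolynomial (Fin 4) K) :
    hsPsi K (MvPolynomial.X 0 * r) = xg K 2 0 * hsPsi K r := by
  have : hsPsi K ∘ₗ LinearMap.mulLeft K (MvPolynomial.X 0) =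
      LinearMap.mulLeft K (xg K 2 0) ∘ₗ hsPsi K := by
    apply hs_ext
    intro m
    simp only [LinearMap.comp_apply, LinearMap.mulLeft_apply, MvPolynomial.X,
      MvPolynomial.monomial_mul, hsPsi_monomial, mul_one]
    simp [add_comm 1, pow_succ', mul_assoc]
  exact LinearMap.congr_fun this r

theorem hsPsi_X3 (K : Type*) [Field K] (r : MvPolynomial (Fin 4) K) :
    hsPsi K (MvPolynomial.X 3 * r) = hsPsi K r * xg K 2 1 := by
  have : hsPsi K ∘ₗ LinearMap.mulLeft K (MvPolynomial.X 3) =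
      LinearMap.mulRight K (xg K 2 1) ∘ₗ hsPsi K := by
    apply hs_ext
    intro m
    simp only [LinearMap.comp_apply, LinearMap.mulLeft_apply, LinearMap.mulRight_apply,
      MvPolynomial.X, MvPolynomial.monomial_mul, hsPsi_monomial, mul_one]
    simp [add_comm 1, pow_succ, mul_assoc]
  exact LinearMap.congr_fun this r

theorem hsPsi_X1 (K : Type*) [Field K] (r : MvPolynomial (Fin 4) K) :
    hsPsi K (MvPolynomial.X 1 * r) = xg K 2 1 * hsPsi K r := by
  have : hsPsi K ∘ₗ LinearMap.mulLeft K (MvPolynomial.X 1) =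
      LinearMap.mulLeft K (xg K 2 1) ∘ₗ hsPsi K := by
    apply hs_ext
    intro m
    simp only [LinearMap.comp_apply, LinearMap.mulLeft_apply, MvPolynomial.X,
      MvPolynomial.monomial_mul, hsPsi_monomial, mul_one]
    have h := hs_comm_zero K (xg K 2 1) (xg K 2 0 ^ m 0) (xg K 2 1 ^ m 1) (xg K 2 0) (xg K 2 1)
    rw [sub_mul, sub_mul, sub_eq_zero] at h
    change _ * hsc K = _ * hsc K at h
    simp only [← mul_assoc]
    rw [h]
    simp [add_comm 1, pow_succ', mul_assoc]
  exact LinearMap.congr_fun this r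

theorem hsPsi_X2 (K : Type*) [Field K] (r : MvPolynomial (Fin 4) K) :
    hsPsi K (MvPolynomial.X 2 * r) = hsPsi K r * xg K 2 0 := by
  have : hsPsi K ∘ₗ LinearMap.mulLeft K (MvPolynomial.X 2) =
      LinearMap.mulRight K (xg K 2 0) ∘ₗ hsPsi K := by
    apply hs_ext
    intro m
    simp only [LinearMap.comp_apply, LinearMap.mulLeft_apply, LinearMap.mulRight_apply,
      MvPolynomial.X, MvPolynomial.monomial_mul, hsPsi_monomial, mul_one]
    have h := hs_comm_zero K (xg K 2 0) (xg K 2 1) (xg K 2 0 ^ m 2) (xg K 2 1 ^ m 3) (xg K 2 0)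
    rw [mul_sub, sub_eq_zero] at h
    change hsc K * _ * _ = hsc K * _ * _ at h
    have e : ∀ y c a b z : FreeMetab K 2, y * c * (a * b) * z = y * (c * a * (b * z)) := by
      intros; noncomm_ring
    rw [e, h]
    simp [add_comm 1, pow_succ, mul_assoc]
  exact LinearMap.congr_fun this r

/-- Induction principle for polynomials in the form used here. -/
theorem hs_ind {K : Type*} [Field K] {P : MvPolynomial (Fin 4) K → Prop}
    (h1 : P 1) (hs : ∀ (a : K) r, P r → P (a • r)) (ha : ∀ r s, P r → P s → P (r + s))
    (hX : ∀ t r, P r → P (MvPolynomial.X t * r)) (r : MvPolynomial (Fin 4) K) : P r := by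
  induction r using MvPolynomial.induction_on with
  | C a =>
    have := hs a 1 h1
    rwa [MvPolynomial.smul_eq_C_mul, mul_one] at this
  | add p q hp hq => exact ha p q hp hq
  | mul_X p t hp => rw [mul_comm]; exact hX t p hp

/-- The matrix representation on the free algebra. -/
def hsPhi0 (K : Type*) [Field K] :
    FreeAlgebra K (Fin 2) →ₐ[K] Matrix (Fin 2) (Fin 2) (MvPolynomial (Fin 4) K) :=
  FreeAlgebra.lift K ![!![MvPolynomial.X 0, 0; 0, MvPolynomial.X 2],
    !![MvPolynomial.X 1, 1; 0, MvPolynomial.X 3]]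

theorem hsPhi0_lower (K : Type*) [Field K] (a : FreeAlgebra K (Fin 2)) : hsPhi0 K a 1 0 = 0 := by
  induction a using FreeAlgebra.induction with
  | grade0 r => simp [AlgHom.commutes, Matrix.algebraMap_matrix_apply]
  | grade1 x => fin_cases x <;> simp [hsPhi0]
  | mul a b ha hb => simp [Matrix.mul_apply, ha, hb]
  | add a b ha hb => simp [ha, hb]

theorem hs_matrix {R : Type*} [CommRing R] (A B C E : Matrix (Fin 2) (Fin 2) R)
    (hA : A 1 0 = 0) (hB : B 1 0 = 0) (hC : C 1 0 = 0) (hE : E 1 0 = 0) :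
    (A * B - B * A) * (C * E - E * C) = 0 := by
  ext i j
  fin_cases i <;> fin_cases j <;>
    simp [Matrix.mul_apply, Fin.sum_univ_two, hA, hB, hC, hE] <;> ring

/-- The matrix representation. -/
def hsPhi (K : Type*) [Field K] :
    FreeMetab K 2 →ₐ[K] Matrix (Fin 2) (Fin 2) (MvPolynomial (Fin 4) K) :=
  RingQuot.liftAlgHom K ⟨hsPhi0 K, by
    rintro x y ⟨rfl, a, b, c, e, rfl⟩
    rw [map_zero, map_mul, map_sub, map_sub, map_mul, map_mul, map_mul, map_mul]
    exact hs_matrix _ _ _ _ (hsPhi0_lower K _) (hsPhi0_lower K _) (hsPhi0_lower K _)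
      (hsPhi0_lower K _)⟩

theorem hsPhi_x0 (K : Type*) [Field K] :
    hsPhi K (xg K 2 0) = !![MvPolynomial.X 0, 0; 0, MvPolynomial.X 2] := by
  rw [hsPhi, xg, RingQuot.liftAlgHom_mkAlgHom_apply]; simp [hsPhi0]

theorem hsPhi_x1 (K : Type*) [Field K] :
    hsPhi K (xg K 2 1) = !![MvPolynomial.X 1, 1; 0, MvPolynomial.X 3] := by
  rw [hsPhi, xg, RingQuot.liftAlgHom_mkAlgHom_apply]; simp [hsPhi0]

theorem hsPhi_Psi (K : Type*) [Field K] (r : MvPolynomial (Fin 4) K) :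
    hsPhi K (hsPsi K r) = !![0, (MvPolynomial.X 0 - MvPolynomial.X 2) * r; 0, 0] := by
  induction r using hs_ind with
  | h1 =>
    rw [hsPsi_one, hsc, map_sub, map_mul, map_mul, hsPhi_x0, hsPhi_x1]
    ext i j
    fin_cases i <;> fin_cases j <;> simp [mul_comm]
  | hs a r ih =>
    rw [map_smul, map_smul, ih]
    simp
  | ha r s hr hs =>
    rw [map_add, map_add, hr, hs]
    simp [mul_add]
  | hX t r ih =>
    fin_cases t
    · show hsPhi K (hsPsi K (MvPolynomial.X 0 * r)) =
        !![0, (MvPolynomial.X 0 - MvPolynomial.X 2) * (MvPolynomial.X 0 * r); 0, 0]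
      rw [hsPsi_X0, map_mul, ih, hsPhi_x0]
      ext i j
      fin_cases i <;> fin_cases j <;> simp
      ring
    · show hsPhi K (hsPsi K (MvPolynomial.X 1 * r)) =
        !![0, (MvPolynomial.X 0 - MvPolynomial.X 2) * (MvPolynomial.X 1 * r); 0, 0]
      rw [hsPsi_X1, map_mul, ih, hsPhi_x1]
      ext i j
      fin_cases i <;> fin_cases j <;> simp
      ring
    · show hsPhi K (hsPsi K (MvPolynomial.X 2 * r)) =
        !![0, (MvPolynomial.X 0 - MvPolynomial.X 2) * (MvPolynomial.X 2 * r); 0, 0]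
      rw [hsPsi_X2, map_mul, ih, hsPhi_x0]
      ext i j
      fin_cases i <;> fin_cases j <;> simp
      ring
    · show hsPhi K (hsPsi K (MvPolynomial.X 3 * r)) =
        !![0, (MvPolynomial.X 0 - MvPolynomial.X 2) * (MvPolynomial.X 3 * r); 0, 0]
      rw [hsPsi_X3, map_mul, ih, hsPhi_x1]
      ext i j
      fin_cases i <;> fin_cases j <;> simp
      ring

theorem hsPsi_inj {K : Type*} [Field K] {r : MvPolynomial (Fin 4) K} (h : hsPsi K r = 0) :
    r = 0 := by
  have h1 := hsPhi_Psi K r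
  rw [h, map_zero] at h1
  have h2 := congrFun (congrFun h1 0) 1
  simp at h2
  refine h2.resolve_left fun h3 => ?_
  rw [sub_eq_zero] at h3
  have := MvPolynomial.X_injective h3
  simp at this

theorem hsPsi_delta {K : Type*} [Field K] (δ : FreeMetab K 2 →ₗ[K] FreeMetab K 2)
    (hleib : ∀ a b : FreeMetab K 2, δ (a * b) = δ a * b + a * δ b)
    (h1 : δ (xg K 2 0) = 0) (h2 : δ (xg K 2 1) = xg K 2 0) (r : MvPolynomial (Fin 4) K) :
    δ (hsPsi K r) = hsPsi K (hsD K r) := by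
  induction r using hs_ind with
  | h1 =>
    rw [hsPsi_one, hsc, map_sub, hleib, hleib, h1, h2]
    simp [hsD_apply]
  | hs a r ih => simp only [map_smul, ih]
  | ha r s hr hs => simp only [map_add, hr, hs]
  | hX t r ih =>
    rw [hsD_mul]
    fin_cases t
    · have e : hsD K (MvPolynomial.X 0) = 0 := by simp [hsD_apply, MvPolynomial.pderiv_X]
      show δ (hsPsi K (MvPolynomial.X 0 * r)) =
        hsPsi K (hsD K (MvPolynomial.X 0) * r + MvPolynomial.X 0 * hsD K r)
      rw [e, zero_mul, zero_add, hsPsi_X0, hsPsi_X0, hleib, h1, ih]; simp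
    · have e : hsD K (MvPolynomial.X 1) = MvPolynomial.X 0 := by
        simp [hsD_apply, MvPolynomial.pderiv_X]
      show δ (hsPsi K (MvPolynomial.X 1 * r)) =
        hsPsi K (hsD K (MvPolynomial.X 1) * r + MvPolynomial.X 1 * hsD K r)
      rw [e, map_add, hsPsi_X0, hsPsi_X1, hsPsi_X1, hleib, h2, ih]
    · have e : hsD K (MvPolynomial.X 2) = 0 := by simp [hsD_apply, MvPolynomial.pderiv_X]
      show δ (hsPsi K (MvPolynomial.X 2 * r)) =
        hsPsi K (hsD K (MvPolynomial.X 2) * r + MvPolynomial.X 2 * hsD K r)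
      rw [e, zero_mul, zero_add, hsPsi_X2, hsPsi_X2, hleib, h1, ih]; simp
    · have e : hsD K (MvPolynomial.X 3) = MvPolynomial.X 2 := by
        simp [hsD_apply, MvPolynomial.pderiv_X]
      show δ (hsPsi K (MvPolynomial.X 3 * r)) =
        hsPsi K (hsD K (MvPolynomial.X 3) * r + MvPolynomial.X 3 * hsD K r)
      rw [e, map_add, hsPsi_X2, hsPsi_X3, hsPsi_X3, hleib, h2, ih, add_comm]

/-- Dehomogenized abelianization. -/
def hsPi (K : Type*) [Field K] : FreeMetab K 2 →ₐ[K] Polynomial K :=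
  RingQuot.liftAlgHom K ⟨FreeAlgebra.lift K ![1, Polynomial.X], by
    rintro x y ⟨rfl, a, b, c, e, rfl⟩
    simp [mul_comm]⟩

theorem hsPi_x0 (K : Type*) [Field K] : hsPi K (xg K 2 0) = 1 := by
  rw [hsPi, xg, RingQuot.liftAlgHom_mkAlgHom_apply]; simp

theorem hsPi_x1 (K : Type*) [Field K] : hsPi K (xg K 2 1) = Polynomial.X := by
  rw [hsPi, xg, RingQuot.liftAlgHom_mkAlgHom_apply]; simp

theorem hsPi_Psi (K : Type*) [Field K] (r : MvPolynomial (Fin 4) K) : hsPi K (hsPsi K r) = 0 := by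
  have : (hsPi K).toLinearMap ∘ₗ hsPsi K = 0 := by
    apply hs_ext
    intro m
    simp [hsPsi_monomial, hsc, mul_comm]
  exact LinearMap.congr_fun this r

theorem hsPi_delta {K : Type*} [Field K] (δ : FreeMetab K 2 →ₗ[K] FreeMetab K 2)
    (hleib : ∀ a b : FreeMetab K 2, δ (a * b) = δ a * b + a * δ b)
    (h1 : δ (xg K 2 0) = 0) (h2 : δ (xg K 2 1) = xg K 2 0) (f : FreeMetab K 2) :
    hsPi K (δ f) = Polynomial.derivative (hsPi K f) := by
  have hone : δ 1 = 0 := by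
    have := hleib 1 1
    simpa using this
  obtain ⟨a, rfl⟩ := RingQuot.mkAlgHom_surjective K (MetabRel K 2) f
  induction a using FreeAlgebra.induction with
  | grade0 r =>
    rw [AlgHom.commutes, AlgHom.commutes, Algebra.algebraMap_eq_smul_one, map_smul, hone]
    simp
  | grade1 x =>
    change hsPi K (δ (xg K 2 x)) = Polynomial.derivative (hsPi K (xg K 2 x))
    fin_cases x
    · show hsPi K (δ (xg K 2 0)) = Polynomial.derivative (hsPi K (xg K 2 0))
      rw [h1, hsPi_x0]; simp
    · show hsPi K (δ (xg K 2 1)) = Polynomial.derivative (hsPi K (xg K 2 1))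
      rw [h2, hsPi_x0, hsPi_x1]; simp
  | mul a b ha hb =>
    rw [map_mul, hleib, map_add, map_mul, map_mul, map_mul, ha, hb, Polynomial.derivative_mul]
  | add a b ha hb => simp only [map_add, ha, hb]

theorem hs_deg_mul {K : Type*} [Field K] {a b : ℕ} {f g : FreeMetab K 2}
    (hf : f ∈ degComp K 2 a) (hg : g ∈ degComp K 2 b) : f * g ∈ degComp K 2 (a + b) := by
  obtain ⟨f, hf, rfl⟩ := hf
  obtain ⟨g, hg, rfl⟩ := hg
  refine ⟨f * g, ?_, by simp⟩
  have := Submodule.mul_mem_mul hf hg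
  rw [Submodule.span_mul_span] at this
  refine Submodule.span_mono ?_ this
  rintro _ ⟨_, ⟨l, hl, rfl⟩, _, ⟨l', hl', rfl⟩, rfl⟩
  exact ⟨l ++ l', by simp [hl, hl'], by simp⟩

theorem hs_deg_one (K : Type*) [Field K] : (1 : FreeMetab K 2) ∈ degComp K 2 0 :=
  ⟨1, Submodule.subset_span ⟨[], rfl, by simp⟩, by simp⟩

theorem hs_deg_x (K : Type*) [Field K] (i : Fin 2) : xg K 2 i ∈ degComp K 2 1 :=
  ⟨FreeAlgebra.ι K i, Submodule.subset_span ⟨[i], rfl, by simp⟩, rfl⟩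

theorem hs_deg_pow (K : Type*) [Field K] (i : Fin 2) (n : ℕ) : xg K 2 i ^ n ∈ degComp K 2 n := by
  induction n with
  | zero => simpa using hs_deg_one K
  | succ n ih => rw [pow_succ]; exact hs_deg_mul ih (hs_deg_x K i)

theorem hs_deg_Psi_mon (K : Type*) [Field K] (m : Fin 4 →₀ ℕ) :
    hsPsi K (MvPolynomial.monomial m 1) ∈ degComp K 2 (m 0 + m 1 + 2 + (m 2 + m 3)) := by
  rw [hsPsi_monomial]
  have hc : hsc K ∈ degComp K 2 2 := by
    have c1 := hs_deg_mul (hs_deg_x K 0) (hs_deg_x K 1)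
    have c2 := hs_deg_mul (hs_deg_x K 1) (hs_deg_x K 0)
    rw [hsc]
    exact Submodule.sub_mem _ c1 c2
  have ha := hs_deg_mul (hs_deg_pow K 0 (m 0)) (hs_deg_pow K 1 (m 1))
  have hb := hs_deg_mul (hs_deg_pow K 0 (m 2)) (hs_deg_pow K 1 (m 3))
  exact hs_deg_mul (hs_deg_mul ha hc) hb

theorem hs_deg_Psi {K : Type*} [Field K] {n : ℕ} {r : MvPolynomial (Fin 4) K}
    (hr : r ∈ hsH K n) : hsPsi K r ∈ degComp K 2 n := by
  have e : hsPsi K r = ∑ m ∈ r.support, r.coeff m • hsPsi K (MvPolynomial.monomial m 1) := by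
    conv_lhs => rw [r.as_sum, map_sum]
    refine Finset.sum_congr rfl fun m _ => ?_
    rw [← map_smul, MvPolynomial.smul_monomial, smul_eq_mul, mul_one]
  rw [e]
  refine Submodule.sum_mem _ fun m hm => Submodule.smul_mem _ _ ?_
  have hn := hr m (MvPolynomial.mem_support_iff.1 hm)
  have hd : n = m 0 + m 1 + 2 + (m 2 + m 3) := by omega
  rw [hd]
  exact hs_deg_Psi_mon K m

theorem hs_straight (K : Type*) [Field K] (a : ℕ) : ∃ r ∈ hsH K (a + 1),
    xg K 2 1 * xg K 2 0 ^ a = xg K 2 0 ^ a * xg K 2 1 + hsPsi K r := by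
  induction a with
  | zero => exact ⟨0, Submodule.zero_mem _, by simp⟩
  | succ a ih =>
    obtain ⟨r, hr, h⟩ := ih
    refine ⟨MvPolynomial.X 2 * r - MvPolynomial.X 0 ^ a * 1,
      Submodule.sub_mem _ (hsH_X_mul hr 2) ?_, ?_⟩
    · have := hsH_X_pow_mul (hsH_one K) 0 a
      rwa [show a + 1 + 1 = 2 + a by ring]
    · have e : ∀ a : ℕ, hsPsi K (MvPolynomial.X 0 ^ a * 1) = xg K 2 0 ^ a * hsc K := by
        intro a
        induction a with
        | zero => simp [hsPsi_one]
        | succ a ih => rw [pow_succ', mul_assoc, hsPsi_X0, ih, pow_succ', mul_assoc]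
      rw [map_sub, hsPsi_X2, e, pow_succ, ← mul_assoc, h, hsc]
      simp only [add_mul, mul_sub, mul_assoc]; abel

theorem hs_straight2 (K : Type*) [Field K] (a b : ℕ) : ∃ r ∈ hsH K (a + b + 1),
    xg K 2 1 * (xg K 2 0 ^ a * xg K 2 1 ^ b) = xg K 2 0 ^ a * xg K 2 1 ^ (b + 1) + hsPsi K r := by
  induction b with
  | zero => simpa using hs_straight K a
  | succ b ih =>
    obtain ⟨r, hr, h⟩ := ih
    refine ⟨MvPolynomial.X 3 * r, hsH_X_mul hr 3, ?_⟩
    rw [hsPsi_X3, pow_succ, ← mul_assoc, ← mul_assoc, mul_assoc (xg K 2 1), h]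
    simp only [pow_succ, add_mul, mul_assoc]

theorem hs_word (K : Type*) [Field K] (l : List (Fin 2)) : ∃ a b : ℕ, a + b = l.length ∧
    ∃ r ∈ hsH K l.length, (l.map (xg K 2)).prod = xg K 2 0 ^ a * xg K 2 1 ^ b + hsPsi K r := by
  induction l with
  | nil => exact ⟨0, 0, rfl, 0, Submodule.zero_mem _, by simp⟩
  | cons i l ih =>
    obtain ⟨a, b, hab, r, hr, h⟩ := ih
    rw [List.map_cons, List.prod_cons, h, List.length_cons]
    fin_cases i
    · refine ⟨a + 1, b, by omega, MvPolynomial.X 0 * r, hsH_X_mul hr 0, ?_⟩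
      rw [hsPsi_X0, pow_succ', mul_add, mul_assoc]
      rfl
    · obtain ⟨s, hs, h'⟩ := hs_straight2 K a b
      rw [hab] at hs
      refine ⟨a, b + 1, by omega, s + MvPolynomial.X 1 * r,
        Submodule.add_mem _ hs (hsH_X_mul hr 1), ?_⟩
      rw [map_add, hsPsi_X1, ← add_assoc, ← h', ← mul_add]
      rfl

/-- Homogenized section of `hsPi`. -/
def hsTheta (K : Type*) [Field K] (n : ℕ) : Polynomial K →ₗ[K] FreeMetab K 2 :=
  (Polynomial.basisMonomials K).constr K fun b => xg K 2 0 ^ (n - b) * xg K 2 1 ^ b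

theorem hsTheta_monomial (K : Type*) [Field K] (n b : ℕ) :
    hsTheta K n (Polynomial.monomial b 1) = xg K 2 0 ^ (n - b) * xg K 2 1 ^ b := by
  have := (Polynomial.basisMonomials K).constr_basis K
    (fun b => xg K 2 0 ^ (n - b) * xg K 2 1 ^ b) b
  rwa [Polynomial.coe_basisMonomials] at this

theorem hsPi_Theta (K : Type*) [Field K] (n : ℕ) (p : Polynomial K) :
    hsPi K (hsTheta K n p) = p := by
  have : (hsPi K).toLinearMap ∘ₗ hsTheta K n = LinearMap.id := by
    apply (Polynomial.basisMonomials K).ext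
    intro b
    rw [Polynomial.coe_basisMonomials, LinearMap.comp_apply, hsTheta_monomial]
    simp [hsPi_x0, hsPi_x1, Polynomial.X_pow_eq_monomial]
  exact LinearMap.congr_fun this p

theorem hs_decomp {K : Type*} [Field K] {n : ℕ} {f : FreeMetab K 2} (hf : f ∈ degComp K 2 n) :
    ∃ p, ∃ r ∈ hsH K n, f = hsTheta K n p + hsPsi K r := by
  obtain ⟨f, hf, rfl⟩ := hf
  have : degComp K 2 n ≤ LinearMap.range (hsTheta K n) ⊔ Submodule.map (hsPsi K) (hsH K n) := by
    rw [degComp, Submodule.map_span, Submodule.span_le]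
    rintro _ ⟨_, ⟨l, rfl, rfl⟩, rfl⟩
    obtain ⟨a, b, hab, r, hr, h⟩ := hs_word K l
    have e : (RingQuot.mkAlgHom K (MetabRel K 2)).toLinearMap
        (l.map (FreeAlgebra.ι K)).prod = (l.map (xg K 2)).prod := by
      rw [AlgHom.toLinearMap_apply, map_list_prod, List.map_map]
      rfl
    rw [e, h]
    refine Submodule.add_mem_sup ⟨Polynomial.monomial b 1, ?_⟩ ⟨r, hr, rfl⟩
    rw [hsTheta_monomial, show l.length - b = a by omega]
  have h := this ⟨f, hf, rfl⟩
  obtain ⟨_, ⟨p, rfl⟩, _, ⟨r, hr, rfl⟩, h⟩ := Submodule.mem_sup.1 h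
  exact ⟨p, r, hr, h.symm⟩

/-- Parametrization of the constants of degree `n`. -/
def hsG (K : Type*) [Field K] (n : ℕ) : K × hsN K n →ₗ[K] FreeMetab K 2 :=
  LinearMap.coprod (LinearMap.toSpanSingleton K _ (xg K 2 0 ^ n)) (hsPsi K ∘ₗ (hsN K n).subtype)

theorem hsG_apply (K : Type*) [Field K] (n : ℕ) (c : K) (r : hsN K n) :
    hsG K n (c, r) = c • xg K 2 0 ^ n + hsPsi K r.1 := by
  simp [hsG]

theorem hsG_inj (K : Type*) [Field K] (n : ℕ) : Function.Injective (hsG K n) := by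
  rw [injective_iff_map_eq_zero]
  rintro ⟨c, r⟩ h
  rw [hsG_apply] at h
  have h1 := congrArg (hsPi K) h
  rw [map_add, hsPi_Psi, map_smul, map_pow, hsPi_x0] at h1
  have hc : c = 0 := by simpa using h1
  subst hc
  rw [zero_smul, zero_add] at h
  have hr : r = 0 := Subtype.ext (hsPsi_inj h)
  rw [hr]
  rfl

theorem hsG_range {K : Type*} [Field K] [CharZero K] (δ : FreeMetab K 2 →ₗ[K] FreeMetab K 2)
    (hleib : ∀ a b : FreeMetab K 2, δ (a * b) = δ a * b + a * δ b)
    (h1 : δ (xg K 2 0) = 0) (h2 : δ (xg K 2 1) = xg K 2 0) (n : ℕ) :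
    LinearMap.range (hsG K n) = LinearMap.ker δ ⊓ degComp K 2 n := by
  have hpow : ∀ n, δ (xg K 2 0 ^ n) = 0 := by
    intro n
    induction n with
    | zero =>
      have := hleib 1 1
      simpa using this
    | succ n ih => rw [pow_succ, hleib, ih, h1]; simp
  apply le_antisymm
  · rintro _ ⟨⟨c, r⟩, rfl⟩
    rw [hsG_apply]
    refine ⟨?_, Submodule.add_mem _ (Submodule.smul_mem _ _ (hs_deg_pow K 0 n))
      (hs_deg_Psi r.2.2)⟩
    show δ _ = 0
    have hr : hsD K r.1 = 0 := r.2.1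
    rw [map_add, map_smul, hpow, hsPsi_delta δ hleib h1 h2, hr]
    simp
  · rintro f ⟨hk, hd⟩
    have hk' : δ f = 0 := hk
    obtain ⟨p, r, hr, rfl⟩ := hs_decomp hd
    have hp := hsPi_delta δ hleib h1 h2 (hsTheta K n p + hsPsi K r)
    rw [hk', map_zero, map_add, hsPi_Psi, hsPi_Theta, add_zero] at hp
    have hp' := Polynomial.eq_C_of_natDegree_eq_zero
      (Polynomial.derivative_eq_zero.1 hp.symm)
    generalize p.coeff 0 = c at hp'
    subst hp'
    have e : hsTheta K n (Polynomial.C c) = c • xg K 2 0 ^ n := by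
      have := hsTheta_monomial K n 0
      have hC : (Polynomial.C c : Polynomial K) = c • Polynomial.monomial 0 1 := by
        rw [Polynomial.smul_monomial, smul_eq_mul, mul_one, Polynomial.monomial_zero_left]
      rw [hC, map_smul, this]
      simp
    rw [e] at hk' ⊢
    rw [map_add, map_smul, hpow, smul_zero, zero_add, hsPsi_delta δ hleib h1 h2] at hk'
    exact ⟨(c, ⟨r, hsPsi_inj hk', hr⟩), hsG_apply K n c _⟩

theorem hs_finrank {K : Type*} [Field K] [CharZero K] (δ : FreeMetab K 2 →ₗ[K] FreeMetab K 2)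
    (hleib : ∀ a b : FreeMetab K 2, δ (a * b) = δ a * b + a * δ b)
    (h1 : δ (xg K 2 0) = 0) (h2 : δ (xg K 2 1) = xg K 2 0) (n : ℕ) :
    Module.finrank K ((LinearMap.ker δ ⊓ degComp K 2 n : Submodule K (FreeMetab K 2))) =
      1 + n^2/4 := by
  have : Module.Finite K (hsN K n) := Module.Finite.equiv (hsCe K n).symm
  rw [← hsG_range δ hleib h1 h2, LinearMap.finrank_range_of_inj (hsG_inj K n),
    Module.finrank_prod, hsN_finrank, Module.finrank_self]

/-- For `d = 2` and the Weitzenböck derivation with `δ(x₁) = 0`,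
`δ(x₂) = x₁`, the Hilbert series of `F₂^δ` satisfies
`(1-z)²(1-z²)·H(F₂^δ,z) = (1-z)(1-z²) + z²`, i.e.
`H(F₂^δ,z) = 1/(1-z) + z²/((1-z)²(1-z²))`. -/
theorem hilbert_series_constants_d2
    (K : Type*) [Field K] [CharZero K]
    (δ : FreeMetab K 2 →ₗ[K] FreeMetab K 2)
    (hleib : ∀ a b : FreeMetab K 2, δ (a * b) = δ a * b + a * δ b)
    (h1 : δ (xg K 2 0) = 0) (h2 : δ (xg K 2 1) = xg K 2 0) :
    (1 - PowerSeries.X : PowerSeries ℤ) ^ 2 * (1 - PowerSeries.X ^ 2) *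
        (PowerSeries.mk fun n => (Module.finrank K
          ((LinearMap.ker δ ⊓ degComp K 2 n : Submodule K (FreeMetab K 2))) : ℤ))
      = (1 - PowerSeries.X) * (1 - PowerSeries.X ^ 2) + PowerSeries.X ^ 2 := by
  exact hs_series _ (hs_finrank δ hleib h1 h2)
end
end

section
/- Let d = 3 and let δ be the Weitzenböck derivation of F_3 with δ(x_1) = 0, δ(x_2) = x_1, δ(x_3) = 0, extended to K[U_3,V_3] by δ(u_1) = δ(v_1) = δ(u_3) = δ(v_3) = 0, δ(u_2) = u_1, δ(v_2) = v_1. Then the K[U_3,V_3]^δ-module (F_3')^δ is generated by the three elements [x_2,x_1], [x_3,x_1], and x_1[x_3,x_2] − x_2[x_3,x_1]. -/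
noncomputable section

namespace WD
open MvPolynomial

abbrev ix : Type := Fin 3 ⊕ Fin 3

section poly
variable (K : Type*) [Field K]

abbrev RR := MvPolynomial ix K

/-- raising derivation -/
def dl : Derivation K (RR K) (RR K) :=
  mkDerivation K (Sum.elim ![0, X (Sum.inl 0), 0] ![0, X (Sum.inr 0), 0])
/-- lowering derivation -/
def lo : Derivation K (RR K) (RR K) :=
  mkDerivation K (Sum.elim ![X (Sum.inl 1), 0, 0] ![X (Sum.inr 1), 0, 0])
def eA : Derivation K (RR K) (RR K) :=
  mkDerivation K (Sum.elim ![X (Sum.inl 0), 0, 0] ![X (Sum.inr 0), 0, 0])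
def eB : Derivation K (RR K) (RR K) :=
  mkDerivation K (Sum.elim ![0, X (Sum.inl 1), 0] ![0, X (Sum.inr 1), 0])

variable {K}

lemma dl_eq (f : RR K) : dl K f = X (Sum.inl 0) * pderiv (Sum.inl 1) f
    + X (Sum.inr 0) * pderiv (Sum.inr 1) f := by
  have : dl K = (X (Sum.inl 0) : RR K) • pderiv (Sum.inl 1)
    + (X (Sum.inr 0) : RR K) • pderiv (Sum.inr 1) := by
    refine derivation_ext fun i => ?_
    rcases i with i | i <;> fin_cases i <;> simp [dl, mkDerivation_X, pderiv_X]
  rw [this]; simp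

lemma lo_eq (f : RR K) : lo K f = X (Sum.inl 1) * pderiv (Sum.inl 0) f
    + X (Sum.inr 1) * pderiv (Sum.inr 0) f := by
  have : lo K = (X (Sum.inl 1) : RR K) • pderiv (Sum.inl 0)
    + (X (Sum.inr 1) : RR K) • pderiv (Sum.inr 0) := by
    refine derivation_ext fun i => ?_
    rcases i with i | i <;> fin_cases i <;> simp [lo, mkDerivation_X, pderiv_X]
  rw [this]; simp

lemma eA_eq (f : RR K) : eA K f = X (Sum.inl 0) * pderiv (Sum.inl 0) f
    + X (Sum.inr 0) * pderiv (Sum.inr 0) f := by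
  have : eA K = (X (Sum.inl 0) : RR K) • pderiv (Sum.inl 0)
    + (X (Sum.inr 0) : RR K) • pderiv (Sum.inr 0) := by
    refine derivation_ext fun i => ?_
    rcases i with i | i <;> fin_cases i <;> simp [eA, mkDerivation_X, pderiv_X]
  rw [this]; simp

lemma eB_eq (f : RR K) : eB K f = X (Sum.inl 1) * pderiv (Sum.inl 1) f
    + X (Sum.inr 1) * pderiv (Sum.inr 1) f := by
  have : eB K = (X (Sum.inl 1) : RR K) • pderiv (Sum.inl 1)
    + (X (Sum.inr 1) : RR K) • pderiv (Sum.inr 1) := by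
    refine derivation_ext fun i => ?_
    rcases i with i | i <;> fin_cases i <;> simp [eB, mkDerivation_X, pderiv_X]
  rw [this]; simp

lemma comm_dl_lo (f : RR K) : dl K (lo K f) = lo K (dl K f) + eA K f - eB K f := by
  have : ⁅dl K, lo K⁆ = eA K - eB K := by
    refine derivation_ext fun i => ?_
    rcases i with i | i <;> fin_cases i <;>
      simp [Derivation.commutator_apply, dl, lo, eA, eB, mkDerivation_X]
  have h2 := congrArg (fun D => D f) this
  simp only [Derivation.commutator_apply, Derivation.sub_apply] at h2
  linear_combination h2

lemma comm_dl_p0 (f : RR K) :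
    dl K (pderiv (Sum.inl 0) f) = pderiv (Sum.inl 0) (dl K f) - pderiv (Sum.inl 1) f := by
  have : ⁅dl K, pderiv (R := K) (σ := ix) (Sum.inl 0)⁆ = - pderiv (Sum.inl 1) := by
    refine derivation_ext fun i => ?_
    rcases i with i | i <;> fin_cases i <;>
      simp [Derivation.commutator_apply, dl, mkDerivation_X, pderiv_X]
  have h2 := congrArg (fun D => D f) this
  simp only [Derivation.commutator_apply, Derivation.neg_apply] at h2
  linear_combination h2

lemma comm_dl_q0 (f : RR K) :
    dl K (pderiv (Sum.inr 0) f) = pderiv (Sum.inr 0) (dl K f) - pderiv (Sum.inr 1) f := by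
  have : ⁅dl K, pderiv (R := K) (σ := ix) (Sum.inr 0)⁆ = - pderiv (Sum.inr 1) := by
    refine derivation_ext fun i => ?_
    rcases i with i | i <;> fin_cases i <;>
      simp [Derivation.commutator_apply, dl, mkDerivation_X, pderiv_X]
  have h2 := congrArg (fun D => D f) this
  simp only [Derivation.commutator_apply, Derivation.neg_apply] at h2
  linear_combination h2

lemma comm_dl_p1 (f : RR K) :
    dl K (pderiv (Sum.inl 1) f) = pderiv (Sum.inl 1) (dl K f) := by
  have : ⁅dl K, pderiv (R := K) (σ := ix) (Sum.inl 1)⁆ = 0 := by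
    refine derivation_ext fun i => ?_
    rcases i with i | i <;> fin_cases i <;>
      simp [Derivation.commutator_apply, dl, mkDerivation_X, pderiv_X]
  have h2 := congrArg (fun D => D f) this
  simp only [Derivation.commutator_apply, Derivation.zero_apply] at h2
  linear_combination h2

lemma comm_dl_q1 (f : RR K) :
    dl K (pderiv (Sum.inr 1) f) = pderiv (Sum.inr 1) (dl K f) := by
  have : ⁅dl K, pderiv (R := K) (σ := ix) (Sum.inr 1)⁆ = 0 := by
    refine derivation_ext fun i => ?_
    rcases i with i | i <;> fin_cases i <;>
      simp [Derivation.commutator_apply, dl, mkDerivation_X, pderiv_X]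
  have h2 := congrArg (fun D => D f) this
  simp only [Derivation.commutator_apply, Derivation.zero_apply] at h2
  linear_combination h2

/-- bidegree weights -/
def wt : ix → ℤ × ℤ := Sum.elim ![(1, 0), (0, 1), 0] ![(1, 0), (0, 1), 0]

abbrev Hm (f : RR K) (a b : ℤ) : Prop := IsWeightedHomogeneous wt f (a, b)

lemma weight_wt (m : ix →₀ ℕ) : Finsupp.weight wt m =
    ((m (Sum.inl 0) + m (Sum.inr 0) : ℤ), (m (Sum.inl 1) + m (Sum.inr 1) : ℤ)) := by
  rw [Finsupp.weight_apply, Finsupp.sum_fintype _ _ (by simp)]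
  ext <;> simp [Fintype.sum_sum_type, Fin.sum_univ_three, wt]

lemma Hm.eA {f : RR K} {a b : ℤ} (h : Hm f a b) : eA K f = (a : K) • f := by
  conv_lhs => rw [f.as_sum]
  conv_rhs => rw [f.as_sum]
  rw [map_sum, Finset.smul_sum]
  refine Finset.sum_congr rfl fun m hm => ?_
  have := h (mem_support_iff.1 hm)
  rw [weight_wt, Prod.mk.injEq] at this
  rw [eA_eq, X_mul_pderiv_monomial, X_mul_pderiv_monomial, ← this.1, ← add_smul]
  rw [← Nat.cast_smul_eq_nsmul K]
  push_cast; rfl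

lemma Hm.eB {f : RR K} {a b : ℤ} (h : Hm f a b) : eB K f = (b : K) • f := by
  conv_lhs => rw [f.as_sum]
  conv_rhs => rw [f.as_sum]
  rw [map_sum, Finset.smul_sum]
  refine Finset.sum_congr rfl fun m hm => ?_
  have := h (mem_support_iff.1 hm)
  rw [weight_wt, Prod.mk.injEq] at this
  rw [eB_eq, X_mul_pderiv_monomial, X_mul_pderiv_monomial, ← this.2, ← add_smul]
  rw [← Nat.cast_smul_eq_nsmul K]
  push_cast; rfl

lemma Hm.dl {f : RR K} {a b : ℤ} (h : Hm f a b) : Hm (dl K f) (a + 1) (b - 1) := by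
  rw [dl_eq]
  have e : ((a + 1, b - 1) : ℤ × ℤ) = (1, 0) + (a, b - 1) := by
    ext <;> simp [add_comm]
  unfold Hm
  rw [e]
  refine IsWeightedHomogeneous.add ?_ ?_
  · exact (isWeightedHomogeneous_X K wt (Sum.inl 0)).mul
      (IsWeightedHomogeneous.pderiv h (by simp [wt]))
  · exact (isWeightedHomogeneous_X K wt (Sum.inr 0)).mul
      (IsWeightedHomogeneous.pderiv h (by simp [wt]))

lemma Hm.lo {f : RR K} {a b : ℤ} (h : Hm f a b) : Hm (lo K f) (a - 1) (b + 1) := by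
  rw [lo_eq]
  have e : ((a - 1, b + 1) : ℤ × ℤ) = (0, 1) + (a - 1, b) := by
    ext <;> simp [add_comm]
  unfold Hm
  rw [e]
  refine IsWeightedHomogeneous.add ?_ ?_
  · exact (isWeightedHomogeneous_X K wt (Sum.inl 1)).mul
      (IsWeightedHomogeneous.pderiv h (by simp [wt]))
  · exact (isWeightedHomogeneous_X K wt (Sum.inr 1)).mul
      (IsWeightedHomogeneous.pderiv h (by simp [wt]))

lemma Hm.p1 {f : RR K} {a b : ℤ} (h : Hm f a b) : Hm (pderiv (Sum.inl 1) f) a (b - 1) :=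
  IsWeightedHomogeneous.pderiv h (by simp [wt])

lemma Hm.q1 {f : RR K} {a b : ℤ} (h : Hm f a b) : Hm (pderiv (Sum.inr 1) f) a (b - 1) :=
  IsWeightedHomogeneous.pderiv h (by simp [wt])

lemma Hm.neg_eq_zero {f : RR K} {a b : ℤ} (h : Hm f a b) (ha : a < 0) : f = 0 := by
  by_contra hf
  obtain ⟨m, hm⟩ := support_nonempty.2 hf
  have := h (mem_support_iff.1 hm)
  rw [weight_wt, Prod.mk.injEq] at this
  omega

lemma Hm.comm {f : RR K} {a b : ℤ} (h : Hm f a b) :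
    WD.dl K (WD.lo K f) = WD.lo K (WD.dl K f) + ((a - b : ℤ) : K) • f := by
  rw [comm_dl_lo, h.eA, h.eB]; push_cast; rw [sub_smul]; abel

lemma Hm.lo_iter {f : RR K} {a b : ℤ} (h : Hm f a b) (k : ℕ) :
    Hm ((WD.lo K)^[k] f) (a - k) (b + k) := by
  induction k with
  | zero => simpa using h
  | succ k ih =>
    rw [Function.iterate_succ_apply']
    have := ih.lo
    push_cast
    rwa [← sub_sub, ← add_assoc]

lemma key_inj [CharZero K] {y : RR K} {a b : ℤ} (h : Hm y a b) (hab : a < b)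
    (hy : lo K (dl K y) = 0) : y = 0 := by
  have step : ∀ k : ℕ, dl K ((lo K)^[k + 1] y)
      = (((k + 1) * (a - b - k) : ℤ) : K) • (lo K)^[k] y := by
    intro k
    induction k with
    | zero => simp [h.comm, hy]
    | succ k ih =>
      rw [Function.iterate_succ_apply', (h.lo_iter (k + 1)).comm, ih, Derivation.map_smul,
        ← Function.iterate_succ_apply' (lo K), ← add_smul]
      congr 1
      push_cast
      ring
  have down : ∀ k : ℕ, (lo K)^[k] y = 0 → y = 0 := by
    intro k
    induction k with
    | zero => simp
    | succ k ih =>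
      intro hk
      apply ih
      have := step k
      rw [hk, map_zero] at this
      refine (smul_eq_zero.1 this.symm).resolve_left ?_
      refine Int.cast_ne_zero.2 ?_
      apply mul_ne_zero <;> omega
  refine down (a.toNat + 1) ((h.lo_iter _).neg_eq_zero ?_)
  push_cast
  omega

/-- The desired shape of an element. -/
def good (K : Type*) [Field K] : Submodule K (RR K) where
  carrier := {h | ∃ α β : RR K, dl K α = 0 ∧ dl K β = 0 ∧
    h = X (Sum.inl 0) * α + X (Sum.inr 0) * β}
  zero_mem' := ⟨0, 0, by simp, by simp, by simp⟩
  add_mem' := by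
    rintro _ _ ⟨a, b, ha, hb, rfl⟩ ⟨a', b', ha', hb', rfl⟩
    exact ⟨a + a', b + b', by simp [*], by simp [*], by ring⟩
  smul_mem' := by
    rintro c _ ⟨a, b, ha, hb, rfl⟩
    refine ⟨c • a, c • b, by simp [*], by simp [*], by simp [smul_add]⟩

lemma good_homog [CharZero K] {h : RR K} {a b : ℤ} (hh : Hm h a b) (hd : dl K h = 0)
    (hab : b < a) (ha : 0 ≤ a) : h ∈ good K := by
  have hn : ((a - b + 1 : ℤ) : K) ≠ 0 := by rw [Int.cast_ne_zero]; omega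
  have hn1 : ((a - b : ℤ) : K) ≠ 0 := by rw [Int.cast_ne_zero]; omega
  have hn2 : ((a + 1 : ℤ) : K) ≠ 0 := by rw [Int.cast_ne_zero]; omega
  have key : ((a - b + 1 : ℤ) : K) • (X (Sum.inl 0) * pderiv (Sum.inl 0) h +
      X (Sum.inr 0) * pderiv (Sum.inr 0) h) +
      (X (Sum.inl 0) * lo K (pderiv (Sum.inl 1) h) + X (Sum.inr 0) * lo K (pderiv (Sum.inr 1) h))
      = (((a - b) * (a + 1) : ℤ) : K) • h := by
    have e1 := hh.eA
    have e2 := hh.eB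
    rw [eA_eq] at e1
    rw [eB_eq] at e2
    have e3 : lo K (dl K h) = 0 := by rw [hd, map_zero]
    have l0 : lo K (X (Sum.inl 0)) = X (Sum.inl 1) := by simp [lo, mkDerivation_X]
    have l1 : lo K (X (Sum.inr 0)) = X (Sum.inr 1) := by simp [lo, mkDerivation_X]
    rw [dl_eq, map_add, Derivation.leibniz, Derivation.leibniz, l0, l1] at e3
    simp only [smul_eq_mul] at e3
    rw [e1, smul_smul]
    have e4 : X (Sum.inl 0) * lo K (pderiv (Sum.inl 1) h) +
      X (Sum.inr 0) * lo K (pderiv (Sum.inr 1) h) = - ((b : K) • h) := by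
      rw [← e2]; linear_combination e3
    rw [e4, ← neg_smul, ← add_smul]
    congr 1
    push_cast; ring
  have : (((a - b) * (a + 1) : ℤ) : K) • h ∈ good K := by
    refine ⟨((a - b + 1 : ℤ) : K) • pderiv (Sum.inl 0) h + lo K (pderiv (Sum.inl 1) h),
      ((a - b + 1 : ℤ) : K) • pderiv (Sum.inr 0) h + lo K (pderiv (Sum.inr 1) h), ?_, ?_, ?_⟩
    · rw [map_add, Derivation.map_smul, comm_dl_p0, hh.p1.comm, comm_dl_p1, hd]
      simp only [map_zero, zero_sub, zero_add, smul_neg]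
      rw [← neg_smul, ← add_smul]
      push_cast
      ring_nf; simp
    · rw [map_add, Derivation.map_smul, comm_dl_q0, hh.q1.comm, comm_dl_q1, hd]
      simp only [map_zero, zero_sub, zero_add, smul_neg]
      rw [← neg_smul, ← add_smul]
      push_cast
      ring_nf; simp
    · rw [← key]
      simp only [mul_add, smul_add, mul_smul_comm]
      abel
  have h2 := (good K).smul_mem ((((a - b) * (a + 1) : ℤ) : K)⁻¹) this
  rwa [inv_smul_smul₀] at h2
  push_cast at *
  exact mul_ne_zero hn1 hn2

lemma good_homog' [CharZero K] {g : RR K} {a b : ℤ} (hg : Hm g a b) (hd : dl K (dl K g) = 0) :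
    dl K g ∈ good K := by
  by_cases ha : a + 1 < 0
  · rw [hg.dl.neg_eq_zero ha]; exact zero_mem _
  rcases lt_trichotomy (a + 1) (b - 1) with h | h | h
  · rw [key_inj hg.dl h (by rw [hd, map_zero])]; exact zero_mem _
  · have h1 : lo K (dl K g) = 0 := by
      refine key_inj hg.dl.lo (by omega) ?_
      rw [hg.dl.comm, hd, h]; simp
    rw [key_inj hg (by omega) h1, map_zero]; exact zero_mem _
  · exact good_homog hg.dl hd h (by omega)

lemma comp_dl (g : RR K) (a b : ℤ) :
    weightedHomogeneousComponent wt (a + 1, b - 1) (dl K g)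
      = dl K (weightedHomogeneousComponent wt (a, b) g) := by
  induction g using MvPolynomial.induction_on' with
  | monomial m c =>
    obtain ⟨⟨a', b'⟩, hab⟩ : ∃ p, p = Finsupp.weight wt m := ⟨_, rfl⟩
    have hm : Hm (monomial m c) a' b' := isWeightedHomogeneous_monomial _ _ _ hab.symm
    by_cases hh : a' = a ∧ b' = b
    · obtain ⟨rfl, rfl⟩ := hh
      rw [hm.weightedHomogeneousComponent_same, hm.dl.weightedHomogeneousComponent_same]
    · rw [hm.weightedHomogeneousComponent_ne, hm.dl.weightedHomogeneousComponent_ne, map_zero]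
      · simp only [ne_eq, Prod.mk.injEq]; omega
      · simp only [ne_eq, Prod.mk.injEq]; omega
  | add p q hp hq => simp only [map_add, hp, hq]

lemma good_of_dl [CharZero K] {g : RR K} (hd : dl K (dl K g) = 0) : dl K g ∈ good K := by
  have h1 := finsum_weightedHomogeneousComponent (w := wt) g
  rw [finsum_eq_sum _ (weightedHomogeneousComponent_finsupp g)] at h1
  rw [← h1, map_sum]
  refine Submodule.sum_mem _ ?_
  rintro ⟨a, b⟩ -
  refine good_homog' (a := a) (b := b) (weightedHomogeneousComponent_isWeightedHomogeneous _ _) ?_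
  rw [← comp_dl, ← comp_dl, hd, map_zero]

/-- set `v₃ = 0` -/
def sg (K : Type*) [Field K] : RR K →ₐ[K] RR K :=
  aeval (fun i => if i = Sum.inr 2 then 0 else X i)

lemma dvd_sub_sg (f : RR K) : X (Sum.inr 2) ∣ f - sg K f := by
  induction f using MvPolynomial.induction_on with
  | C a => simp [sg]
  | add p q hp hq =>
    rw [map_add, add_sub_add_comm]; exact dvd_add hp hq
  | mul_X p i hp =>
    have : p * X i - sg K (p * X i) = (p - sg K p) * X i + sg K p * (X i - sg K (X i)) := by
      rw [map_mul]; ring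
    rw [this]
    refine dvd_add (hp.mul_right _) (Dvd.dvd.mul_left ?_ _)
    by_cases hi : i = Sum.inr 2 <;> simp [sg, hi]

lemma sg_dl (f : RR K) : sg K (dl K f) = dl K (sg K f) := by
  induction f using MvPolynomial.induction_on with
  | C a => simp [sg]
  | add p q hp hq => simp [hp, hq]
  | mul_X p i hp =>
    simp only [map_mul, Derivation.leibniz, smul_eq_mul, map_add, hp]
    congr 2
    rcases i with i | i <;> fin_cases i <;> simp [sg, dl, mkDerivation_X]

lemma dl_v3 : dl K (X (Sum.inr 2)) = 0 := by simp [dl, mkDerivation_X]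

lemma div_v3 {f q : RR K} (h : dl K f = q * X (Sum.inr 2)) : ∃ p, dl K p = q := by
  obtain ⟨p, hp⟩ := dvd_sub_sg f
  refine ⟨p, ?_⟩
  have h1 : dl K (f - sg K f) = q * X (Sum.inr 2) := by
    rw [map_sub, ← sg_dl, h, map_mul]; simp [sg]
  rw [hp, Derivation.leibniz, dl_v3] at h1
  simp only [smul_eq_mul, mul_zero, add_zero] at h1
  refine mul_left_cancel₀ (X_ne_zero (R := K) (Sum.inr 2)) ?_
  rw [h1, mul_comm]

lemma koszul {f g h : RR K} (h1 : f * X (Sum.inr 0) = h * X (Sum.inr 2))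
    (h2 : g * X (Sum.inr 0) + h * X (Sum.inr 1) = 0) :
    ∃ q, f = q * X (Sum.inr 2) ∧ g = - (q * X (Sum.inr 1)) ∧ h = q * X (Sum.inr 0) := by
  have hX0 : (X (Sum.inr 0) : RR K) ≠ 0 := X_ne_zero _
  have hX2 : (X (Sum.inr 2) : RR K) ≠ 0 := X_ne_zero _
  have hs : sg K f = 0 := by
    have := congrArg (sg K) h1
    simpa [sg] using this
  obtain ⟨q, hq⟩ := dvd_sub_sg f
  rw [hs, sub_zero] at hq
  have hh : h = q * X (Sum.inr 0) := by
    apply mul_right_cancel₀ hX2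
    rw [← h1, hq]; ring
  refine ⟨q, by rw [hq, mul_comm], ?_, hh⟩
  apply mul_right_cancel₀ hX0
  rw [hh] at h2
  linear_combination h2

end poly
end WD

namespace WD
open MvPolynomial

lemma exists_hom {K E ι : Type*} [Field K] [Semiring E] [Algebra K E] (op : ι → E)
    (h : ∀ i j, op i * op j = op j * op i) :
    ∃ φ : MvPolynomial ι K →ₐ[K] E, ∀ i, φ (X i) = op i := by
  have hc := Algebra.isMulCommutative_adjoin K (s := Set.range op) (by
    rintro _ ⟨i, rfl⟩ _ ⟨j, rfl⟩
    exact h i j)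
  let _ : CommSemiring (Algebra.adjoin K (Set.range op)) :=
    { (Algebra.adjoin K (Set.range op)).toSemiring with mul_comm := hc.is_comm.comm }
  let ψ : MvPolynomial ι K →ₐ[K] Algebra.adjoin K (Set.range op) :=
    aeval (fun i => (⟨op i, Algebra.subset_adjoin ⟨i, rfl⟩⟩ : Algebra.adjoin K (Set.range op)))
  refine ⟨(Algebra.adjoin K (Set.range op)).val.comp ψ, fun i => ?_⟩
  have : ψ (X i) = ⟨op i, Algebra.subset_adjoin ⟨i, rfl⟩⟩ := aeval_X _ _
  rw [AlgHom.comp_apply, this]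
  rfl

lemma ring_id1 {R : Type*} [Ring R] (m z y : R) :
    m * z * y = (m * z - z * m) * y + z * (m * y) := by noncomm_ring

lemma ring_id2 {R : Type*} [Ring R] (x a b : R) :
    x * (a * b) - a * b * x = (x * a - a * x) * b + a * (x * b - b * x) := by noncomm_ring

lemma ring_id3 {R : Type*} [Ring R] (x a b : R) :
    a * b * x - x * (a * b) = (a * x - x * a) * b + a * (b * x - x * b) := by noncomm_ring

lemma ring_id4 {R : Type*} [Ring R] (x y z : R) :
    ((y * x - x * y) * z - z * (y * x - x * y)) + ((z * y - y * z) * x - x * (z * y - y * z))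
     = (z * x - x * z) * y - y * (z * x - x * z) := by noncomm_ring

section alg
variable {K : Type*} [Field K]

abbrev FF (K : Type*) [Field K] := FreeMetab K 3

lemma cc (a b c e : FF K) : (a * b - b * a) * (c * e - e * c) = 0 := by
  have hs := RingQuot.mkAlgHom_surjective K (MetabRel K 3)
  obtain ⟨a, rfl⟩ := hs a
  obtain ⟨b, rfl⟩ := hs b
  obtain ⟨c, rfl⟩ := hs c
  obtain ⟨e, rfl⟩ := hs e
  have := RingQuot.mkAlgHom_rel K (s := MetabRel K 3)
    (x := (a * b - b * a) * (c * e - e * c)) (y := 0) ⟨rfl, a, b, c, e, rfl⟩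
  simpa using this

lemma cxc (a b z c e : FF K) : (a * b - b * a) * z * (c * e - e * c) = 0 := by
  have h1 := cc a b c e
  have h2 := cc (a * b - b * a) z c e
  rw [ring_id1, h1, h2]; simp

lemma ci_ind {P : FF K → Prop} (hg : ∀ a f g b, P (a * (f * g - g * f) * b)) (h0 : P 0)
    (hadd : ∀ x y, P x → P y → P (x + y)) {w : FF K} (hw : w ∈ commIdeal K 3) : P w := by
  have : ∀ w ∈ commIdeal K 3, ∀ r, P (r * w) := by
    intro w hw
    unfold commIdeal at hw
    induction hw using Submodule.span_induction with
    | mem x h =>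
      obtain ⟨a, f, g, b, rfl⟩ := h
      intro r
      rw [← mul_assoc, ← mul_assoc]
      exact hg _ _ _ _
    | zero => intro r; simpa using h0
    | add x y _ _ hx hy => intro r; rw [mul_add]; exact hadd _ _ (hx r) (hy r)
    | smul a x _ hx => intro r; rw [smul_eq_mul, ← mul_assoc]; exact hx _
  simpa using this w hw 1

lemma comm_mul_ci (a b : FF K) {w : FF K} (hw : w ∈ commIdeal K 3) : (a * b - b * a) * w = 0 := by
  refine ci_ind (P := fun w => (a * b - b * a) * w = 0) ?_ ?_ ?_ hw
  · intro c f g d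
    rw [← mul_assoc, ← mul_assoc, cxc, zero_mul]
  · simp
  · intro x y hx hy
    rw [mul_add, hx, hy, add_zero]

lemma ci_mul_comm (a b : FF K) {w : FF K} (hw : w ∈ commIdeal K 3) : w * (a * b - b * a) = 0 := by
  refine ci_ind (P := fun w => w * (a * b - b * a) = 0) ?_ ?_ ?_ hw
  · intro c f g d
    rw [mul_assoc, mul_assoc, ← mul_assoc _ d, cxc, mul_zero]
  · simp
  · intro x y hx hy
    rw [add_mul, hx, hy, add_zero]

lemma ci_mul_right (z : FF K) {w : FF K} (hw : w ∈ commIdeal K 3) : w * z ∈ commIdeal K 3 := by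
  refine ci_ind (P := fun w => w * z ∈ commIdeal K 3) ?_ ?_ ?_ hw
  · intro c f g d
    exact Ideal.subset_span ⟨c, f, g, d * z, by rw [mul_assoc _ d]⟩
  · simp
  · intro x y hx hy
    rw [add_mul]; exact add_mem hx hy

lemma ci_comm (f g : FF K) : f * g - g * f ∈ commIdeal K 3 :=
  Ideal.subset_span ⟨1, f, g, 1, by simp⟩

abbrev CI (K : Type*) [Field K] : Submodule K (FF K) := (commIdeal K 3).restrictScalars K

def opL (i : Fin 3) : Module.End K (CI K) :=
  (LinearMap.mulLeft K (xg K 3 i)).restrict (fun _ hw => Ideal.mul_mem_left _ _ hw)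
def opA (i : Fin 3) : Module.End K (CI K) :=
  (LinearMap.mulRight K (xg K 3 i) - LinearMap.mulLeft K (xg K 3 i)).restrict
    (fun _ hw => (commIdeal K 3).sub_mem (ci_mul_right _ hw) (Ideal.mul_mem_left _ _ hw))

def op : ix → Module.End K (CI K) := Sum.elim opL opA

@[simp] lemma op_inl (i : Fin 3) (w : CI K) :
    (op (K := K) (Sum.inl i) w : FF K) = xg K 3 i * w := rfl
@[simp] lemma op_inr (i : Fin 3) (w : CI K) :
    (op (K := K) (Sum.inr i) w : FF K) = w * xg K 3 i - xg K 3 i * w := rfl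

lemma op_comm (i j : ix) : op (K := K) i * op j = op j * op i := by
  refine LinearMap.ext fun w => Subtype.ext ?_
  have l : ∀ a b : FF K, a * (b * (w : FF K)) = b * (a * w) := fun a b => by
    have := comm_mul_ci a b w.2
    rw [sub_mul, sub_eq_zero] at this
    simpa [mul_assoc] using this
  have r : ∀ a b : FF K, (w : FF K) * a * b = w * b * a := fun a b => by
    have := ci_mul_comm a b w.2
    rw [mul_sub, sub_eq_zero] at this
    simpa [mul_assoc] using this
  rcases i with i | i <;> rcases j with j | j <;>
    simp only [Module.End.mul_apply, op_inl, op_inr, mul_sub, sub_mul]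
  · exact l _ _
  · rw [l (xg K 3 i), mul_assoc]
  · rw [l (xg K 3 j), mul_assoc]
  · rw [l (xg K 3 i), r (xg K 3 i)]; simp only [mul_assoc]; abel

def ph : RR K →ₐ[K] Module.End K (CI K) := (exists_hom (K := K) (op (K := K)) op_comm).choose

lemma ph_X (i : ix) : ph (X i) = op (K := K) i := (exists_hom (K := K) (op (K := K)) op_comm).choose_spec i

lemma monAct_eq (m : ix →₀ ℕ) (w : CI K) :
    monAct K 3 m (w : FF K) = ph (monomial m 1) w := by
  have hL : ∀ (i : Fin 3) (n : ℕ) (w : CI K),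
      ((LinearMap.mulLeft K (xg K 3 i) : Module.End K (FF K)) ^ n) (w : FF K)
        = ((op (Sum.inl i) ^ n : Module.End K (CI K)) w : FF K) := by
    intro i n
    induction n with
    | zero => intro w; simp
    | succ n ih =>
      intro w
      rw [pow_succ, pow_succ, Module.End.mul_apply, Module.End.mul_apply, ← ih]; rfl
  have hR : ∀ (i : Fin 3) (n : ℕ) (w : CI K),
      ((LinearMap.mulRight K (xg K 3 i) - LinearMap.mulLeft K (xg K 3 i) :
        Module.End K (FF K)) ^ n) (w : FF K)
        = ((op (Sum.inr i) ^ n : Module.End K (CI K)) w : FF K) := by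
    intro i n
    induction n with
    | zero => intro w; simp
    | succ n ih =>
      intro w
      rw [pow_succ, pow_succ, Module.End.mul_apply, Module.End.mul_apply, ← ih]; rfl
  have e : (monomial m (1 : K) : RR K) =
      (X (Sum.inl 0) ^ m (Sum.inl 0) * (X (Sum.inl 1) ^ m (Sum.inl 1) *
       (X (Sum.inl 2) ^ m (Sum.inl 2)))) * (X (Sum.inr 0) ^ m (Sum.inr 0) *
       (X (Sum.inr 1) ^ m (Sum.inr 1) * (X (Sum.inr 2) ^ m (Sum.inr 2)))) := by
    rw [monomial_eq, Finsupp.prod_fintype _ _ (by simp), Fintype.prod_sum_type,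
      Fin.prod_univ_three, Fin.prod_univ_three]
    simp [mul_assoc]
  rw [e]
  simp only [map_mul, map_pow, ph_X, monAct, List.ofFn_succ, List.ofFn_zero, List.prod_cons,
    List.prod_nil, mul_one, Module.End.mul_apply]
  simp only [Fin.succ_zero_eq_one, Fin.succ_one_eq_two, hL, hR]

lemma act_eq (p : RR K) (w : CI K) : act K 3 p (w : FF K) = ph p w := by
  conv_rhs => rw [p.as_sum]
  unfold act
  rw [map_sum, LinearMap.sum_apply, Submodule.coe_sum]
  refine Finset.sum_congr rfl fun m _ => ?_
  rw [monAct_eq, ← Submodule.coe_smul, ← LinearMap.smul_apply, ← map_smul, smul_monomial]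
  simp

lemma ff_ind {P : FF K → Prop} (hc : ∀ r : K, P (algebraMap K _ r)) (hx : ∀ i, P (xg K 3 i))
    (hmul : ∀ a b, P a → P b → P (a * b)) (hadd : ∀ a b, P a → P b → P (a + b)) (w : FF K) :
    P w := by
  obtain ⟨a, rfl⟩ := RingQuot.mkAlgHom_surjective K (MetabRel K 3) w
  induction a with
  | grade0 r => simpa using hc r
  | grade1 i => exact hx i
  | mul a b ha hb => rw [map_mul]; exact hmul _ _ ha hb
  | add a b ha hb => rw [map_add]; exact hadd _ _ ha hb

def cm (i j : Fin 3) : CI K := ⟨xg K 3 i * xg K 3 j - xg K 3 j * xg K 3 i, ci_comm _ _⟩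

lemma surj {w : FF K} (hw : w ∈ commIdeal K 3) : ∃ f g h : RR K,
    w = ((ph f (cm 1 0) + ph g (cm 2 0) + ph h (cm 2 1) : CI K) : FF K) := by
  let T : Submodule K (FF K) :=
    { carrier := {w | ∃ f g h : RR K,
        w = ((ph f (cm 1 0) + ph g (cm 2 0) + ph h (cm 2 1) : CI K) : FF K)}
      zero_mem' := ⟨0, 0, 0, by simp⟩
      add_mem' := by
        rintro _ _ ⟨f, g, h, rfl⟩ ⟨f', g', h', rfl⟩
        refine ⟨f + f', g + g', h + h', ?_⟩
        simp only [map_add, LinearMap.add_apply, Submodule.coe_add]; abel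
      smul_mem' := by
        rintro c _ ⟨f, g, h, rfl⟩
        refine ⟨c • f, c • g, c • h, ?_⟩
        simp only [map_smul, LinearMap.smul_apply, Submodule.coe_add, Submodule.coe_smul, smul_add] }
  have hop : ∀ (i : ix) (f g h : RR K),
      ((op i (ph f (cm 1 0) + ph g (cm 2 0) + ph h (cm 2 1)) : CI K) : FF K) ∈ T := by
    intro i f g h
    refine ⟨X i * f, X i * g, X i * h, ?_⟩
    simp only [map_mul, Module.End.mul_apply, ph_X, map_add]
  have hl : ∀ a : FF K, ∀ w ∈ T, a * w ∈ T := by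
    intro a
    induction a using ff_ind with
    | hc r => intro w hw; rw [← Algebra.smul_def]; exact T.smul_mem _ hw
    | hx i =>
      rintro w ⟨f, g, h, rfl⟩
      exact hop (Sum.inl i) f g h
    | hmul a b ha hb => intro w hw; rw [mul_assoc]; exact ha _ (hb _ hw)
    | hadd a b ha hb => intro w hw; rw [add_mul]; exact add_mem (ha _ hw) (hb _ hw)
  have hr : ∀ a : FF K, ∀ w ∈ T, w * a ∈ T := by
    intro a
    induction a using ff_ind with
    | hc r => intro w hw; rw [← Algebra.commutes, ← Algebra.smul_def]; exact T.smul_mem _ hw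
    | hx i =>
      rintro w ⟨f, g, h, rfl⟩
      have := add_mem (hop (Sum.inr i) f g h) (hop (Sum.inl i) f g h)
      simpa only [op_inl, op_inr, sub_add_cancel] using this
    | hmul a b ha hb => intro w hw; rw [← mul_assoc]; exact hb _ (ha _ hw)
    | hadd a b ha hb => intro w hw; rw [mul_add]; exact add_mem (ha _ hw) (hb _ hw)
  have m10 : (cm 1 0 : CI K).1 ∈ T := ⟨1, 0, 0, by simp⟩
  have m20 : (cm 2 0 : CI K).1 ∈ T := ⟨0, 1, 0, by simp⟩
  have m21 : (cm 2 1 : CI K).1 ∈ T := ⟨0, 0, 1, by simp⟩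
  have hxx : ∀ i j, xg K 3 i * xg K 3 j - xg K 3 j * xg K 3 i ∈ T := by
    have n10 := T.neg_mem m10
    have n20 := T.neg_mem m20
    have n21 := T.neg_mem m21
    simp only [cm, neg_sub] at m10 m20 m21 n10 n20 n21
    intro i j
    fin_cases i <;> fin_cases j <;> first | assumption | simp
  have hxf : ∀ i (f : FF K), xg K 3 i * f - f * xg K 3 i ∈ T := by
    intro i f
    induction f using ff_ind with
    | hc r => rw [Algebra.commutes, sub_self]; exact zero_mem _
    | hx j => exact hxx i j
    | hmul a b ha hb =>
      have := add_mem (hr b _ ha) (hl a _ hb)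
      rwa [ring_id2]
    | hadd a b ha hb => rw [mul_add, add_mul, add_sub_add_comm]; exact add_mem ha hb
  have hff : ∀ (e f : FF K), e * f - f * e ∈ T := by
    intro e f
    induction e using ff_ind with
    | hc r => rw [Algebra.commutes, sub_self]; exact zero_mem _
    | hx j => exact hxf j f
    | hmul a b ha hb =>
      have := add_mem (hr b _ ha) (hl a _ hb)
      rwa [ring_id3]
    | hadd a b ha hb => rw [mul_add, add_mul, add_sub_add_comm]; exact add_mem ha hb
  exact ci_ind (P := fun w => w ∈ T) (fun a f g b => hr _ _ (hl _ _ (hff _ _))) (zero_mem _)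
    (fun x y hx hy => add_mem hx hy) hw

/-- Magnus type representation -/
def mg0 (t : Fin 3 → RR K) : FreeAlgebra K (Fin 3) →ₐ[K] Matrix (Fin 2) (Fin 2) (RR K) :=
  FreeAlgebra.lift K (fun i => !![X (Sum.inl i), t i; 0, X (Sum.inl i) + X (Sum.inr i)])

lemma mg0_low (t : Fin 3 → RR K) (a : FreeAlgebra K (Fin 3)) : mg0 t a 1 0 = 0 := by
  induction a with
  | grade0 r => simp [Matrix.algebraMap_matrix_apply]
  | grade1 i => simp [mg0]
  | mul a b ha hb => simp [Matrix.mul_apply, ha, hb]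
  | add a b ha hb => simp [ha, hb]

def mg (t : Fin 3 → RR K) : FF K →ₐ[K] Matrix (Fin 2) (Fin 2) (RR K) :=
  RingQuot.liftAlgHom K ⟨mg0 t, by
    rintro _ _ ⟨rfl, a, b, c, e, rfl⟩
    have ha := mg0_low t a
    have hb := mg0_low t b
    have hc := mg0_low t c
    have he := mg0_low t e
    refine Matrix.ext fun i j => ?_
    fin_cases i <;> fin_cases j <;>
      simp [Matrix.mul_apply, ha, hb, hc, he, Fin.sum_univ_two] <;> ring_nf <;> simp⟩

lemma mg_x (t : Fin 3 → RR K) (i : Fin 3) :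
    mg t (xg K 3 i) = !![X (Sum.inl i), t i; 0, X (Sum.inl i) + X (Sum.inr i)] := by
  simp [mg, xg, mg0]

lemma mg_low (t : Fin 3 → RR K) (a : FF K) : mg t a 1 0 = 0 := by
  obtain ⟨a, rfl⟩ := RingQuot.mkAlgHom_surjective K (MetabRel K 3) a
  simp [mg, mg0_low]

lemma mg_ci (t : Fin 3 → RR K) {w : FF K} (hw : w ∈ commIdeal K 3) :
    mg t w 0 0 = 0 ∧ mg t w 1 1 = 0 := by
  refine ci_ind (P := fun w => mg t w 0 0 = 0 ∧ mg t w 1 1 = 0) ?_ ?_ ?_ hw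
  · intro a f g b
    have ha := mg_low t a
    have hb := mg_low t b
    have hf := mg_low t f
    have hg := mg_low t g
    constructor <;> simp [Matrix.mul_apply, ha, hb, hf, hg, Fin.sum_univ_two] <;> ring_nf <;> simp
  · simp
  · intro x y hx hy
    simp [hx, hy]

lemma mg_ph (t : Fin 3 → RR K) (p : RR K) (w : CI K) :
    mg t (ph p w : CI K) 0 1 = p * mg t w 0 1 := by
  induction p using MvPolynomial.induction_on generalizing w with
  | C a =>
    have : ph (C a : RR K) = algebraMap K _ a := ph.commutes a
    rw [this, Module.algebraMap_end_apply, Submodule.coe_smul, map_smul]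
    simp [MvPolynomial.smul_eq_C_mul]
  | add p q hp hq => simp [hp, hq, add_mul]
  | mul_X p i hp =>
    rw [map_mul, Module.End.mul_apply, hp, ph_X, mul_assoc]
    congr 1
    obtain ⟨h0, h1⟩ := mg_ci t w.2
    have h2 := mg_low t w
    rcases i with i | i
    · rw [op_inl, map_mul, mg_x, Matrix.mul_apply]
      simp [h1, Fin.sum_univ_two]
    · rw [op_inr, map_sub, map_mul, map_mul, mg_x, Matrix.sub_apply, Matrix.mul_apply,
        Matrix.mul_apply]
      simp [h0, h1, Fin.sum_univ_two]; ring

lemma mg_cm (t : Fin 3 → RR K) (i j : Fin 3) :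
    mg t (cm i j : CI K) 0 1 = t i * X (Sum.inr j) - t j * X (Sum.inr i) := by
  simp [cm, mg_x]; ring

lemma syz {f g h : RR K} (e : ph f (cm 1 0) + ph g (cm 2 0) + ph h (cm 2 1) = 0) :
    ∃ q, f = q * X (Sum.inr 2) ∧ g = - (q * X (Sum.inr 1)) ∧ h = q * X (Sum.inr 0) := by
  have key : ∀ t : Fin 3 → RR K, f * (t 1 * X (Sum.inr 0) - t 0 * X (Sum.inr 1)) +
      g * (t 2 * X (Sum.inr 0) - t 0 * X (Sum.inr 2)) +
      h * (t 2 * X (Sum.inr 1) - t 1 * X (Sum.inr 2)) = 0 := by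
    intro t
    have := congrArg (fun z : CI K => mg t z 0 1) e
    simpa [mg_ph, mg_cm] using this
  have k1 := key ![0, 1, 0]
  have k2 := key ![0, 0, 1]
  simp at k1 k2
  exact koszul (by linear_combination k1) k2

/-- The Jacobi identity. -/
lemma jac (p : RR K) : ph (p * X (Sum.inr 2)) (cm 1 0) + ph (p * X (Sum.inr 0)) (cm 2 1)
    = ph (p * X (Sum.inr 1)) (cm 2 0) := by
  have h2 : op (Sum.inr 2) (cm 1 0 : CI K) + op (Sum.inr 0) (cm 2 1)
      = op (Sum.inr 1) (cm 2 0) :=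
    Subtype.ext (ring_id4 (xg K 3 0) (xg K 3 1) (xg K 3 2))
  have h3 := congrArg (ph p) h2
  rw [map_add] at h3
  simp only [map_mul, Module.End.mul_apply, ph_X]
  exact h3

lemma der (δ : FF K →ₗ[K] FF K) (hleib : ∀ a b, δ (a * b) = δ a * b + a * δ b)
    (h1 : δ (xg K 3 0) = 0) (h2 : δ (xg K 3 1) = xg K 3 0) (h3 : δ (xg K 3 2) = 0)
    (p : RR K) (w w' : CI K) (hw : δ w = w') :
    δ (ph p w : CI K) = ((ph (dl K p) w + ph p w' : CI K) : FF K) := by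
  induction p using MvPolynomial.induction_on with
  | C a =>
    have : ph (C a : RR K) = algebraMap K _ a := ph.commutes a
    rw [this]
    simp [hw]
  | add p q hp hq =>
    simp only [map_add, LinearMap.add_apply, Submodule.coe_add, hp, hq]; abel
  | mul_X p i hp =>
    rw [mul_comm, map_mul, Module.End.mul_apply, ph_X, Derivation.leibniz, map_add]
    simp only [smul_eq_mul, map_mul, Module.End.mul_apply, LinearMap.add_apply, ph_X,
      Submodule.coe_add]
    have hc : ∀ q : RR K, ph p (ph q w) = ph q (ph p w) := fun q => by
      rw [← Module.End.mul_apply, ← map_mul, mul_comm, map_mul, Module.End.mul_apply]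
    rw [hc]
    have d0 : ∀ i, dl K (X (Sum.inl i)) = (![0, X (Sum.inl 0), 0] : Fin 3 → RR K) i := fun i => by
      simp [dl, mkDerivation_X]
    have d1 : ∀ i, dl K (X (Sum.inr i)) = (![0, X (Sum.inr 0), 0] : Fin 3 → RR K) i := fun i => by
      simp [dl, mkDerivation_X]
    rcases i with i | i
    · simp only [op_inl, hleib, hp, d0, Submodule.coe_add]
      fin_cases i <;> simp [h1, h2, h3, ph_X] <;> noncomm_ring
    · simp only [op_inr, hleib, map_sub, hp, d1, Submodule.coe_add]
      fin_cases i <;> simp [h1, h2, h3, ph_X] <;> noncomm_ring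

end alg
end WD

theorem WD.main {K : Type*} [Field K] [CharZero K] (δ : FreeMetab K 3 →ₗ[K] FreeMetab K 3)
    (hleib : ∀ a b : FreeMetab K 3, δ (a * b) = δ a * b + a * δ b)
    (h1 : δ (xg K 3 0) = 0) (h2 : δ (xg K 3 1) = xg K 3 0) (h3 : δ (xg K 3 2) = 0)
    {w : FreeMetab K 3} (hw : w ∈ commIdeal K 3) (hd : δ w = 0) :
    ∃ f g h : WD.RR K, WD.dl K f = 0 ∧ WD.dl K g = 0 ∧ WD.dl K h = 0 ∧
      w = (WD.ph f (WD.cm 1 0) : WD.CI K).1 + (WD.ph g (WD.cm 2 0) : WD.CI K).1 +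
      (WD.ph h (WD.op (Sum.inl 0) (WD.cm 2 1) - WD.op (Sum.inl 1) (WD.cm 2 0)) : WD.CI K).1 := by
  open WD MvPolynomial in
  obtain ⟨f, g, h, e⟩ := surj hw
  have hd10 : δ (cm 1 0 : CI K) = (0 : CI K) := by
    simp [cm, hleib, h1, h2]
  have hd20 : δ (cm 2 0 : CI K) = (0 : CI K) := by
    simp [cm, hleib, h1, h3]
  have hd21 : δ (cm 2 1 : CI K) = (cm 2 0 : CI K) := by
    simp [cm, hleib, h1, h2, h3]
  have e2 : ph (dl K f) (cm 1 0) + ph (dl K g + h) (cm 2 0) + ph (dl K h) (cm 2 1)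
      = (0 : CI K) := by
    apply Subtype.ext
    rw [e] at hd
    simp only [Submodule.coe_add, map_add] at hd
    rw [der δ hleib h1 h2 h3 _ _ _ hd10, der δ hleib h1 h2 h3 _ _ _ hd20,
      der δ hleib h1 h2 h3 _ _ _ hd21] at hd
    simp only [Submodule.coe_add, map_add, map_zero, add_zero, LinearMap.add_apply] at hd ⊢
    rw [Submodule.coe_zero, ← hd]
    abel
  obtain ⟨q, q1, q2, q3⟩ := syz e2
  obtain ⟨p, rfl⟩ := div_v3 q1
  have dv0 : dl K (X (Sum.inr 0)) = 0 := by simp [dl, mkDerivation_X]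
  have dv1 : dl K (X (Sum.inr 1)) = X (Sum.inr 0) := by simp [dl, mkDerivation_X]
  have du0 : dl K (X (Sum.inl 0)) = 0 := by simp [dl, mkDerivation_X]
  have du1 : dl K (X (Sum.inl 1)) = X (Sum.inl 0) := by simp [dl, mkDerivation_X]
  -- normalise
  obtain ⟨f', hf'⟩ : ∃ f', f' = f - p * X (Sum.inr 2) := ⟨_, rfl⟩
  obtain ⟨g', hg'⟩ : ∃ g', g' = g + p * X (Sum.inr 1) := ⟨_, rfl⟩
  obtain ⟨h', hh'⟩ : ∃ h', h' = h - p * X (Sum.inr 0) := ⟨_, rfl⟩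
  have df' : dl K f' = 0 := by
    rw [hf', map_sub, Derivation.leibniz, dl_v3, q1, smul_eq_mul, smul_eq_mul]; ring
  have dg' : dl K (-g') = h' := by
    rw [map_neg, hg', map_add, Derivation.leibniz, dv1, hh', smul_eq_mul, smul_eq_mul]
    linear_combination -q2
  have dh' : dl K h' = 0 := by
    rw [hh', map_sub, Derivation.leibniz, dv0, q3, smul_eq_mul, smul_eq_mul]; ring
  obtain ⟨α, β, hα, hβ, hab⟩ : h' ∈ good K := by
    rw [← dg']; apply good_of_dl; rw [dg', dh']
  refine ⟨f' - β * X (Sum.inr 2), g' + α * X (Sum.inl 1) + β * X (Sum.inr 1), α, ?_, ?_, hα, ?_⟩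
  · rw [map_sub, df', Derivation.leibniz, hβ, dl_v3]; simp
  · rw [map_neg] at dg'
    rw [map_add, map_add, Derivation.leibniz, Derivation.leibniz, hα, hβ, du1, dv1]
    simp only [smul_eq_mul]
    linear_combination -dg' - hab
  · have ef : f = (f' - β * X (Sum.inr 2)) + (p + β) * X (Sum.inr 2) := by
      rw [hf']; ring
    have eg : g' + α * X (Sum.inl 1) + β * X (Sum.inr 1) = g + α * X (Sum.inl 1)
        + (p + β) * X (Sum.inr 1) := by
      rw [hg']; ring
    have eh : h = α * X (Sum.inl 0) + (p + β) * X (Sum.inr 0) := by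
      linear_combination hab - hh'
    have j := jac (K := K) (p + β)
    have ef2 := congrArg (fun z => ph z (cm 1 0)) ef
    have eg2 := congrArg (fun z => ph z (cm 2 0)) eg
    have eh2 := congrArg (fun z => ph z (cm 2 1)) eh
    rw [map_add ph, LinearMap.add_apply] at ef2 eh2
    rw [map_add ph (g + _), map_add ph g, LinearMap.add_apply, LinearMap.add_apply] at eg2
    have es : ph α (op (Sum.inl 0) (cm 2 1) - op (Sum.inl 1) (cm 2 0)) +
        ph (α * X (Sum.inl 1)) (cm 2 0) = ph (α * X (Sum.inl 0)) (cm 2 1) := by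
      rw [map_mul ph, map_mul ph, Module.End.mul_apply, Module.End.mul_apply, ph_X, ph_X,
        ← map_add]
      exact congrArg (ph α) (Subtype.ext (sub_add_cancel _ _))
    rw [e, ← Submodule.coe_add, ← Submodule.coe_add]
    congr 1
    rw [ef2, eg2, eh2, ← es, ← j]
    abel

/-- For `d = 3` and the Weitzenböck derivation with `δ(x₁) = 0`,
`δ(x₂) = x₁`, `δ(x₃) = 0`, the `K[U₃,V₃]^δ`-module `(F₃')^δ` is generated by
`[x₂,x₁]`, `[x₃,x₁]` and `x₁[x₃,x₂] - x₂[x₃,x₁]`. -/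
theorem module_generators_d3_cells_2_1
    (K : Type*) [Field K] [CharZero K]
    (δ : FreeMetab K 3 →ₗ[K] FreeMetab K 3)
    (hleib : ∀ a b : FreeMetab K 3, δ (a * b) = δ a * b + a * δ b)
    (h1 : δ (xg K 3 0) = 0) (h2 : δ (xg K 3 1) = xg K 3 0) (h3 : δ (xg K 3 2) = 0)
    (δ' : Derivation K (PolyUV K 3) (PolyUV K 3))
    (hu1 : δ' (uP K 3 0) = 0) (hu2 : δ' (uP K 3 1) = uP K 3 0) (hu3 : δ' (uP K 3 2) = 0)
    (hv1 : δ' (vP K 3 0) = 0) (hv2 : δ' (vP K 3 1) = vP K 3 0) (hv3 : δ' (vP K 3 2) = 0) :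
    ∀ w ∈ commIdeal K 3, δ w = 0 →
      ∃ (N : ℕ) (h : Fin N → PolyUV K 3) (sel : Fin N → Fin 3),
        (∀ r, δ' (h r) = 0) ∧
        w = ∑ r, act K 3 (h r)
          (![xg K 3 1 * xg K 3 0 - xg K 3 0 * xg K 3 1,
             xg K 3 2 * xg K 3 0 - xg K 3 0 * xg K 3 2,
             xg K 3 0 * (xg K 3 2 * xg K 3 1 - xg K 3 1 * xg K 3 2)
               - xg K 3 1 * (xg K 3 2 * xg K 3 0 - xg K 3 0 * xg K 3 2)]
            (sel r)) := by
  intro w hw hd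
  obtain rfl : δ' = WD.dl K := by
    simp only [uP, vP] at hu1 hu2 hu3 hv1 hv2 hv3
    refine MvPolynomial.derivation_ext fun i => ?_
    rcases i with i | i <;> fin_cases i <;>
      simp [WD.dl, MvPolynomial.mkDerivation_X, hu1, hu2, hu3, hv1, hv2, hv3]
  obtain ⟨f, g, h, hf, hg, hh, e⟩ := WD.main δ hleib h1 h2 h3 hw hd
  refine ⟨3, ![f, g, h], id, ?_, ?_⟩
  · intro r
    fin_cases r
    · exact hf
    · exact hg
    · exact hh
  · rw [e, Fin.sum_univ_three, ← WD.act_eq, ← WD.act_eq, ← WD.act_eq]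
    rfl
end
end
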